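/- For every real number p with 2 ≤ p ≤ 6 there exists a constant C > 0 such that for all k ∈ ℕ and all f ∈ ℋ_k, one has ‖f‖_{L^p(S²)} ≤ C · (1+k)^{(p−2)/(4p)} · ‖f‖_{L²(S²)}. -/

import Mathlib

open MeasureTheory Metric MvPolynomial

/-- The standard surface measure on the unit sphere `S² ⊆ ℝ³`. -/
noncomputable def sphereMeasure : Measure (sphere (0 : EuclideanSpace ℝ (Fin 3)) 1) :=
  (volume : Measure (EuclideanSpace ℝ (Fin 3))).toSphere

/-- `f : S² → ℂ` belongs to `ℋ_k`, i.e. it is the restriction to the unit sphere of a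
complex-valued polynomial on `ℝ³` that is homogeneous of degree `k` and harmonic. -/
def IsSphericalHarmonic (k : ℕ) (f : sphere (0 : EuclideanSpace ℝ (Fin 3)) 1 → ℂ) : Prop :=
  ∃ P : MvPolynomial (Fin 3) ℂ,
    P.IsHomogeneous k ∧
    (∑ i : Fin 3, pderiv i (pderiv i P)) = 0 ∧
    ∀ x : sphere (0 : EuclideanSpace ℝ (Fin 3)) 1,
      f x = MvPolynomial.eval (fun i => ((x : EuclideanSpace ℝ (Fin 3)) i : ℂ)) P

/-- The normalised central binomial coefficient `binom(2 * n, n) / 4 ^ n`. -/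
noncomputable def normBinom (n : ℕ) : ℝ := (Nat.centralBinom n : ℝ) / 4 ^ n

lemma normBinom_pos (n : ℕ) : 0 < normBinom n := by
  have := Nat.centralBinom_pos n
  unfold normBinom
  positivity

@[simp] lemma normBinom_zero : normBinom 0 = 1 := by simp [normBinom]

lemma normBinom_succ (n : ℕ) :
    normBinom (n + 1) = normBinom n * ((2 * n + 1) / (2 * n + 2)) := by
  have h : ((n : ℝ) + 1) * (Nat.centralBinom (n + 1) : ℝ) =
      2 * (2 * n + 1) * (Nat.centralBinom n : ℝ) := by
    exact_mod_cast Nat.succ_mul_centralBinom_succ n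
  unfold normBinom
  have h4 : (4 : ℝ) ^ n ≠ 0 := by positivity
  have hn : (n : ℝ) + 1 ≠ 0 := by positivity
  rw [pow_succ]
  field_simp
  linear_combination 2 * h

lemma normBinom_sq_le (n : ℕ) : normBinom n ^ 2 * (2 * n + 1) ≤ 1 := by
  induction n with
  | zero => simp
  | succ n ih =>
    refine le_trans ?_ ih
    rw [normBinom_succ, mul_pow, mul_assoc]
    refine mul_le_mul_of_nonneg_left ?_ (sq_nonneg _)
    push_cast
    rw [div_pow, div_mul_eq_mul_div, div_le_iff₀ (by positivity)]
    have : (0 : ℝ) ≤ n := n.cast_nonneg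
    nlinarith

lemma one_le_normBinom_sq (n : ℕ) : 1 ≤ normBinom n ^ 2 * (4 * n + 1) := by
  induction n with
  | zero => simp
  | succ n ih =>
    refine le_trans ih ?_
    rw [normBinom_succ, mul_pow, mul_assoc]
    refine mul_le_mul_of_nonneg_left ?_ (sq_nonneg _)
    push_cast
    rw [div_pow, div_mul_eq_mul_div, le_div_iff₀ (by positivity)]
    have : (0 : ℝ) ≤ n := n.cast_nonneg
    nlinarith

/-- The convolution square of `normBinom` is the constant sequence `1`. -/
lemma sum_antidiagonal_normBinom (n : ℕ) :
    ∑ p ∈ Finset.HasAntidiagonal.antidiagonal n, normBinom p.1 * normBinom p.2 = 1 := by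
  induction n with
  | zero => simp
  | succ n ih =>
    have hswap : ∀ m : ℕ, ∑ p ∈ Finset.HasAntidiagonal.antidiagonal m,
      (p.1 : ℝ) * (normBinom p.1 * normBinom p.2)
        = ∑ p ∈ Finset.HasAntidiagonal.antidiagonal m,
          (p.2 : ℝ) * (normBinom p.1 * normBinom p.2) := by
      intro m
      rw [← Finset.Nat.sum_antidiagonal_swap]
      exact Finset.sum_congr rfl fun p _ => by simp only [Prod.fst_swap, Prod.snd_swap]; ring
    have hdouble : ∀ m : ℕ,
        2 * ∑ p ∈ Finset.HasAntidiagonal.antidiagonal m, (p.1 : ℝ) * (normBinom p.1 * normBinom p.2)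
        = m * ∑ p ∈ Finset.HasAntidiagonal.antidiagonal m, normBinom p.1 * normBinom p.2 := by
      intro m
      rw [two_mul]
      nth_rewrite 2 [hswap]
      rw [← Finset.sum_add_distrib, Finset.mul_sum]
      refine Finset.sum_congr rfl fun p hp => ?_
      have : (p.1 : ℝ) + p.2 = m := by exact_mod_cast Finset.HasAntidiagonal.mem_antidiagonal.1 hp
      rw [← this]; ring
    have h1 := hdouble (n + 1)
    have h2 : 2 * ∑ p ∈ Finset.HasAntidiagonal.antidiagonal (n + 1),
      (p.1 : ℝ) * (normBinom p.1 * normBinom p.2)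
        = 2 * ∑ p ∈ Finset.HasAntidiagonal.antidiagonal n,
          (p.1 : ℝ) * (normBinom p.1 * normBinom p.2)
          + ∑ p ∈ Finset.HasAntidiagonal.antidiagonal n, normBinom p.1 * normBinom p.2 := by
      rw [Finset.Nat.sum_antidiagonal_succ, Nat.cast_zero, zero_mul, zero_add, Finset.mul_sum,
        Finset.mul_sum, ← Finset.sum_add_distrib]
      refine Finset.sum_congr rfl fun p _ => ?_
      rw [normBinom_succ]
      push_cast
      field_simp
    rw [h1, hdouble, ih] at h2
    have : ((n : ℝ) + 1) ≠ 0 := by positivity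
    push_cast at h2
    exact mul_left_cancel₀ this (by linarith)

/-- The Legendre polynomials, as functions on the real line. -/
noncomputable def legendreFun : ℕ → ℝ → ℝ
  | 0, _ => 1
  | 1, t => t
  | n + 2, t => ((2 * n + 3) * t * legendreFun (n + 1) t - (n + 1) * legendreFun n t) / (n + 2)

lemma legendreFun_zero (t : ℝ) : legendreFun 0 t = 1 := by rw [legendreFun]

lemma legendreFun_one (t : ℝ) : legendreFun 1 t = t := by rw [legendreFun]

lemma legendreFun_succ_succ (n : ℕ) (t : ℝ) :
    (n + 2) * legendreFun (n + 2) t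
      = (2 * n + 3) * t * legendreFun (n + 1) t - (n + 1) * legendreFun n t := by
  rw [legendreFun]
  field_simp

lemma mul_legendreFun_succ (n : ℕ) (t : ℝ) :
    t * legendreFun (n + 1) t =
      (n + 2) / (2 * n + 3) * legendreFun (n + 2) t + (n + 1) / (2 * n + 3) * legendreFun n t := by
  have := legendreFun_succ_succ n t
  field_simp
  linear_combination -this

lemma legendreFun_at_one (n : ℕ) : legendreFun n 1 = 1 := by
  induction n using Nat.twoStepInduction with
  | zero => rw [legendreFun]
  | one => rw [legendreFun]
  | more n h0 h1 =>
    have := legendreFun_succ_succ n 1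
    rw [h0, h1] at this
    have h : (n : ℝ) + 2 ≠ 0 := by positivity
    exact mul_left_cancel₀ h (by linarith)

lemma continuous_legendreFun (n : ℕ) : Continuous (legendreFun n) := by
  induction n using Nat.twoStepInduction with
  | zero => simp only [legendreFun]; fun_prop
  | one => simp only [legendreFun]; fun_prop
  | more n h0 h1 => simp only [legendreFun]; fun_prop

/-- The coefficients in Adams' expansion of a product of Legendre polynomials. -/
noncomputable def adamsCoeff (r a b : ℕ) : ℝ :=
  normBinom r * normBinom a * normBinom b / normBinom (a + b + r) *
    ((2 * a + 2 * b + 1) / (2 * a + 2 * b + 2 * r + 1))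

lemma adamsCoeff_comm (r a b : ℕ) : adamsCoeff r a b = adamsCoeff r b a := by
  unfold adamsCoeff
  rw [add_comm a b]
  ring

lemma adamsCoeff_nonneg (r a b : ℕ) : 0 ≤ adamsCoeff r a b := by
  have := normBinom_pos
  unfold adamsCoeff
  have h1 := this r
  have h2 := this a
  have h3 := this b
  have h4 := this (a + b + r)
  positivity

lemma adamsCoeff_rec (r a d : ℕ) :
    (r + a + 2) * adamsCoeff (r + 1) (a + 1) (a + 1 + d) =
      (2 * (r + a) + 3) * ((2 * a + d + 2) / (2 * (2 * a + d + 1) + 1)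
          * adamsCoeff (r + 1) a (a + (d + 1))
        + (2 * a + d + 3) / (2 * (2 * a + d + 2) + 3) * adamsCoeff r (a + 1) (a + 1 + (d + 1)))
      - (r + a + 1) * adamsCoeff r a (a + (d + 2)) := by
  unfold adamsCoeff
  have e1 : a + 1 + (a + 1 + d) + (r + 1) = (2 * a + d + r + 1 + 1) + 1 := by ring
  have e2 : a + (a + (d + 1)) + (r + 1) = (2 * a + d + r + 1) + 1 := by ring
  have e3 : a + 1 + (a + 1 + (d + 1)) + r = (2 * a + d + r + 1 + 1) + 1 := by ring
  have e4 : a + (a + (d + 2)) + r = (2 * a + d + r + 1) + 1 := by ring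
  have e5 : a + 1 + d = a + d + 1 := by ring
  have e6 : a + (d + 1) = a + d + 1 := by ring
  have e7 : a + 1 + (d + 1) = a + d + 1 + 1 := by ring
  have e8 : a + (d + 2) = a + d + 1 + 1 := by ring
  rw [e1, e2, e3, e4, e5, e6, e7, e8]
  simp only [normBinom_succ]
  have h1 := (normBinom_pos r).ne'
  have h2 := (normBinom_pos a).ne'
  have h3 := (normBinom_pos (a + d)).ne'
  have h4 := (normBinom_pos (2 * a + d + r)).ne'
  push_cast
  field_simp
  ring

lemma adamsCoeff_rec_left (m d : ℕ) :
    (m + 2) * adamsCoeff 0 (m + 2) (m + 2 + d) =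
      (2 * m + 3) * ((2 * m + d + 4) / (2 * (2 * m + d + 3) + 1)
          * adamsCoeff 0 (m + 1) (m + 1 + (d + 1))) := by
  unfold adamsCoeff
  have e1 : m + 2 + (m + 2 + d) + 0 = (2 * m + d + 1 + 1 + 1) + 1 := by ring
  have e2 : m + 1 + (m + 1 + (d + 1)) + 0 = (2 * m + d + 1 + 1) + 1 := by ring
  have e3 : m + 2 + d = m + d + 1 + 1 := by ring
  have e4 : m + 1 + (d + 1) = m + d + 1 + 1 := by ring
  have e5 : m + 2 = m + 1 + 1 := by ring
  rw [e1, e2, e3, e4, e5]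
  simp only [normBinom_succ]
  have h2 := (normBinom_pos m).ne'
  have h3 := (normBinom_pos (m + d)).ne'
  have h4 := (normBinom_pos (2 * m + d)).ne'
  push_cast
  field_simp
  ring

lemma adamsCoeff_rec_right (m d : ℕ) :
    (m + 2) * adamsCoeff (m + 2) 0 (0 + d) =
      (2 * m + 3) * ((d + 1) / (2 * d + 3) * adamsCoeff (m + 1) 0 (0 + (d + 1))) := by
  unfold adamsCoeff
  have e1 : 0 + (0 + d) + (m + 2) = (d + m + 1) + 1 := by ring
  have e2 : 0 + (0 + (d + 1)) + (m + 1) = (d + m + 1) + 1 := by ring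
  have e3 : 0 + d = d := by ring
  have e4 : 0 + (d + 1) = d + 1 := by ring
  have e5 : m + 2 = m + 1 + 1 := by ring
  rw [e1, e2, e3, e4, e5]
  simp only [normBinom_succ]
  have h2 := (normBinom_pos m).ne'
  have h3 := (normBinom_pos d).ne'
  have h4 := (normBinom_pos (d + m)).ne'
  push_cast
  field_simp
  ring

/-- Adams' formula for the product of two Legendre polynomials. -/
lemma legendreFun_mul (t : ℝ) (m d : ℕ) :
    legendreFun m t * legendreFun (m + d) t =
      ∑ p ∈ Finset.HasAntidiagonal.antidiagonal m,
        adamsCoeff p.1 p.2 (p.2 + d) * legendreFun (2 * p.2 + d) t := by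
  induction m using Nat.twoStepInduction generalizing d with
  | zero =>
    have h := (normBinom_pos d).ne'
    simp [legendreFun, adamsCoeff, h]
    rw [div_self (by positivity), one_mul]
  | one =>
    have h := (normBinom_pos d).ne'
    simp only [zero_add, Finset.Nat.antidiagonal_succ, Finset.Nat.antidiagonal_zero,
      Finset.map_singleton,
      Finset.cons_eq_insert]
    rw [Finset.sum_insert (by simp), Finset.sum_singleton]
    simp only [Function.Embedding.prodMap, Function.Embedding.coeFn_mk, Prod.map,
      Function.Embedding.refl_apply, legendreFun_one]
    rw [add_comm 1 d, mul_legendreFun_succ]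
    unfold adamsCoeff
    rw [show 1 + (d + 1) + 0 = d + 1 + 1 by ring, show 0 + (0 + d) + Nat.succ 0 = d + 1 by ring,
      show 2 * 1 + d = d + 2 by ring]
    simp only [zero_add, Nat.succ_eq_add_one, normBinom_zero, mul_zero,
      normBinom_succ d, normBinom_succ (d + 1), show normBinom 1 = 1 / 2 by
        simpa using normBinom_succ 0]
    push_cast
    field_simp
    ring
  | more m h0 h1 =>
    have hm : (m : ℝ) + 2 ≠ 0 := by positivity
    apply mul_left_cancel₀ hm
    have key : ((m : ℝ) + 2) * (legendreFun (m + 2) t * legendreFun (m + 2 + d) t) =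
        (2 * m + 3) * (t * (legendreFun (m + 1) t * legendreFun (m + 1 + (d + 1)) t)) -
        (m + 1) * (legendreFun m t * legendreFun (m + (d + 2)) t) := by
      rw [show m + 1 + (d + 1) = m + 2 + d by ring, show m + (d + 2) = m + 2 + d by ring]
      linear_combination legendreFun (m + 2 + d) t * legendreFun_succ_succ m t
    have hmul : t * ∑ p ∈ Finset.HasAntidiagonal.antidiagonal (m + 1),
          adamsCoeff p.1 p.2 (p.2 + (d + 1)) * legendreFun (2 * p.2 + (d + 1)) t =
        ∑ p ∈ Finset.HasAntidiagonal.antidiagonal (m + 1),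
          (2 * p.2 + d + 2) / (2 * (2 * p.2 + d + 1) + 1) *
            adamsCoeff p.1 p.2 (p.2 + (d + 1)) * legendreFun (2 * p.2 + d + 2) t +
        ∑ p ∈ Finset.HasAntidiagonal.antidiagonal (m + 1),
          (2 * p.2 + d + 1) / (2 * (2 * p.2 + d) + 3) *
            adamsCoeff p.1 p.2 (p.2 + (d + 1)) * legendreFun (2 * p.2 + d) t := by
      rw [Finset.mul_sum, ← Finset.sum_add_distrib]
      refine Finset.sum_congr rfl fun p _ => ?_
      rw [mul_left_comm, ← add_assoc (2 * p.2) d 1, mul_legendreFun_succ]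
      push_cast
      field_simp
      ring
    rw [key, h1, h0, hmul, Finset.Nat.sum_antidiagonal_succ,
      Finset.Nat.sum_antidiagonal_succ', Finset.Nat.sum_antidiagonal_succ,
        Finset.Nat.sum_antidiagonal_succ']
    have hsum : ((m : ℝ) + 2) * ∑ p ∈ Finset.HasAntidiagonal.antidiagonal m,
          adamsCoeff (p.1 + 1) (p.2 + 1) (p.2 + 1 + d) * legendreFun (2 * (p.2 + 1) + d) t =
        (2 * m + 3) * (∑ p ∈ Finset.HasAntidiagonal.antidiagonal m,
          (2 * p.2 + d + 2) / (2 * (2 * p.2 + d + 1) + 1) *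
            adamsCoeff (p.1 + 1) p.2 (p.2 + (d + 1)) * legendreFun (2 * p.2 + d + 2) t +
          ∑ p ∈ Finset.HasAntidiagonal.antidiagonal m,
            (2 * ((p.2 + 1 : ℕ) : ℝ) + d + 1) / (2 * (2 * ((p.2 + 1 : ℕ) : ℝ) + d) + 3) *
            adamsCoeff p.1 (p.2 + 1) (p.2 + 1 + (d + 1)) * legendreFun (2 * (p.2 + 1) + d) t) -
        (m + 1) * ∑ p ∈ Finset.HasAntidiagonal.antidiagonal m,
          adamsCoeff p.1 p.2 (p.2 + (d + 2)) * legendreFun (2 * p.2 + (d + 2)) t := by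
      rw [← Finset.sum_add_distrib, Finset.mul_sum, Finset.mul_sum, Finset.mul_sum,
        ← Finset.sum_sub_distrib]
      refine Finset.sum_congr rfl fun p hp => ?_
      have hp' : (m : ℝ) = p.1 + p.2 :=
        by exact_mod_cast (Finset.HasAntidiagonal.mem_antidiagonal.1 hp).symm
      rw [show 2 * (p.2 + 1) + d = 2 * p.2 + d + 2 by ring, ← add_assoc (2 * p.2) d 2, hp']
      have := adamsCoeff_rec p.1 p.2 d
      push_cast
      rw [show (2 * ((p.2 : ℝ) + 1) + d + 1) = 2 * p.2 + d + 3 by ring,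
        show (2 * ((p.2 : ℝ) + 1) + d) = 2 * p.2 + d + 2 by ring]
      linear_combination legendreFun (2 * p.2 + d + 2) t * this
    have hl := adamsCoeff_rec_left m d
    have hr := adamsCoeff_rec_right m d
    rw [show 2 * (m + 1) + d + 2 = 2 * (m + 2) + d by ring]
    push_cast
    rw [show (2 * ((m : ℝ) + 1) + d + 2) = 2 * m + d + 4 by ring,
        show (2 * ((m : ℝ) + 1) + d + 1) = 2 * m + d + 3 by ring]
    simp only [mul_zero, zero_add] at hr ⊢
    push_cast at hsum
    linear_combination -legendreFun (2 * (m + 2) + d) t * hl - legendreFun d t * hr - hsum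
/-- The coefficient of `legendreFun l` in the product `legendreFun m * legendreFun n`. -/
noncomputable def legendreMulCoeff (m n l : ℕ) : ℝ :=
  if m ≤ n + l ∧ n ≤ m + l ∧ l ≤ m + n ∧ Even (m + n + l) then
    adamsCoeff ((m + n - l) / 2) ((m + l - n) / 2) ((n + l - m) / 2) else 0

lemma legendreMulCoeff_comm (m n l : ℕ) : legendreMulCoeff m n l = legendreMulCoeff n m l := by
  unfold legendreMulCoeff
  rw [add_comm n m, adamsCoeff_comm]
  congr 1
  simp only [eq_iff_iff]
  tauto

lemma legendreFun_mul_eq_sum (m n N : ℕ) (hN : m + n < N) (t : ℝ) :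
    legendreFun m t * legendreFun n t =
      ∑ l ∈ Finset.range N, legendreMulCoeff m n l * legendreFun l t := by
  wlog hmn : m ≤ n generalizing m n
  · rw [mul_comm, this n m (by omega) (by omega)]
    simp_rw [legendreMulCoeff_comm n m]
  obtain ⟨d, rfl⟩ := Nat.exists_eq_add_of_le hmn
  rw [legendreFun_mul]
  refine Finset.sum_of_injOn (fun p => 2 * p.2 + d) ?_ ?_ ?_ ?_
  · intro p hp q hq h
    have hp' := Finset.HasAntidiagonal.mem_antidiagonal.1 (Finset.mem_coe.1 hp)
    have hq' := Finset.HasAntidiagonal.mem_antidiagonal.1 (Finset.mem_coe.1 hq)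
    simp only at h
    ext <;> omega
  · intro p hp
    have hp' := Finset.HasAntidiagonal.mem_antidiagonal.1 (Finset.mem_coe.1 hp)
    simp only [Finset.coe_range, Set.mem_Iio]
    omega
  · intro l _ hl
    unfold legendreMulCoeff
    rw [if_neg, zero_mul]
    rintro ⟨h1, h2, h3, e, he⟩
    refine hl ⟨((m + (m + d) - l) / 2, (l - d) / 2), ?_, ?_⟩
    · rw [Finset.mem_coe, Finset.HasAntidiagonal.mem_antidiagonal]
      simp only
      omega
    · simp only
      omega
  · intro p hp
    have hp' := Finset.HasAntidiagonal.mem_antidiagonal.1 hp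
    unfold legendreMulCoeff
    rw [if_pos ⟨by omega, by omega, by omega, ⟨m + d + p.2, by omega⟩⟩]
    congr 2 <;> omega

lemma adamsCoeff_le_sqrt (r a b : ℕ) (X : ℝ)
    (hX : (4 * (a + b + r) + 1) ≤ X * ((2 * a + 1) * (2 * b + 1) : ℝ)) :
    adamsCoeff r a b ≤ normBinom r * √X := by
  have hr := normBinom_pos r
  have ha := normBinom_pos a
  have hb := normBinom_pos b
  have hc := normBinom_pos (a + b + r)
  have hfrac : (2 * a + 2 * b + 1 : ℝ) / (2 * a + 2 * b + 2 * r + 1) ≤ 1 := by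
    rw [div_le_one (by positivity)]
    have : (0 : ℝ) ≤ r := r.cast_nonneg
    linarith
  have h1 : adamsCoeff r a b ≤ normBinom r * normBinom a * normBinom b / normBinom (a + b + r) :=
    mul_le_of_le_one_right (by positivity) hfrac
  refine h1.trans ?_
  rw [mul_assoc, mul_div_assoc]
  refine mul_le_mul_of_nonneg_left (Real.le_sqrt_of_sq_le ?_) hr.le
  have ha2 := normBinom_sq_le a
  have hb2 := normBinom_sq_le b
  have hc2 := one_le_normBinom_sq (a + b + r)
  push_cast at hc2
  rw [div_pow, div_le_iff₀ (by positivity), mul_pow]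
  have hX0 : 0 ≤ X := by
    by_contra! h
    have : X * ((2 * a + 1) * (2 * b + 1) : ℝ) ≤ 0 :=
      mul_nonpos_of_nonpos_of_nonneg h.le (by positivity)
    have : (0 : ℝ) ≤ 4 * (a + b + r) + 1 := by positivity
    linarith
  have hab : normBinom a ^ 2 * normBinom b ^ 2 * ((2 * a + 1) * (2 * b + 1)) ≤ 1 := by
    calc _ = (normBinom a ^ 2 * (2 * a + 1)) * (normBinom b ^ 2 * (2 * b + 1)) := by ring
      _ ≤ 1 := mul_le_one₀ ha2 (by positivity) hb2
  have hpos : (0 : ℝ) < (2 * a + 1) * (2 * b + 1) := by positivity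
  refine le_of_mul_le_mul_right ?_ hpos
  calc _ ≤ (1 : ℝ) := hab
    _ ≤ normBinom (a + b + r) ^ 2 * (4 * (a + b + r) + 1) := hc2
    _ ≤ normBinom (a + b + r) ^ 2 * (X * ((2 * a + 1) * (2 * b + 1))) :=
        mul_le_mul_of_nonneg_left hX (sq_nonneg _)
    _ = _ := by ring

/-- The coefficients of the cube of a Legendre polynomial in the Legendre basis. -/
noncomputable def legendreCubeCoeff (k l : ℕ) : ℝ :=
  ∑ p ∈ Finset.HasAntidiagonal.antidiagonal k,
    adamsCoeff p.1 p.2 p.2 * legendreMulCoeff (2 * p.2) k l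

lemma legendreFun_cube (k : ℕ) (t : ℝ) :
    legendreFun k t ^ 3 =
      ∑ l ∈ Finset.range (3 * k + 1), legendreCubeCoeff k l * legendreFun l t := by
  have h := legendreFun_mul t k 0
  simp only [add_zero] at h
  rw [pow_succ, pow_two, h, Finset.sum_mul]
  simp_rw [legendreCubeCoeff, Finset.sum_mul]
  rw [Finset.sum_comm]
  refine Finset.sum_congr rfl fun p hp => ?_
  have hp' := Finset.HasAntidiagonal.mem_antidiagonal.1 hp
  rw [mul_assoc, legendreFun_mul_eq_sum (2 * p.2) k (3 * k + 1) (by omega), Finset.mul_sum]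
  exact Finset.sum_congr rfl fun l _ => by ring

lemma legendreCubeCoeff_le (k l : ℕ) (hl : 3 * k ≤ 2 * l + 1) :
    legendreCubeCoeff k l ≤ 40 / (k + 1) := by
  have hterm : ∀ p ∈ Finset.HasAntidiagonal.antidiagonal k,
      adamsCoeff p.1 p.2 p.2 * legendreMulCoeff (2 * p.2) k l ≤
        if k ≤ 2 * p.2 + l ∧ l ≤ 2 * p.2 + k ∧ Even (2 * p.2 + k + l) then
          normBinom p.1 * normBinom ((2 * p.2 + k - l) / 2) * (40 / (k + 1)) else 0 := by
    intro p hp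
    have hp' := Finset.HasAntidiagonal.mem_antidiagonal.1 hp
    unfold legendreMulCoeff
    by_cases hc : 2 * p.2 ≤ k + l ∧ k ≤ 2 * p.2 + l ∧ l ≤ 2 * p.2 + k ∧ Even (2 * p.2 + k + l)
    · rw [if_pos hc, if_pos hc.2]
      obtain ⟨h1, h2, h3, e, he⟩ := hc
      have hk0 : (0 : ℝ) ≤ k := k.cast_nonneg
      have b1 := adamsCoeff_le_sqrt p.1 p.2 p.2 (32 / (k + 1)) (by
        have e1 : (k : ℝ) ≤ 4 * p.2 + 1 := by exact_mod_cast (by omega : k ≤ 4 * p.2 + 1)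
        have e2 : (p.1 : ℝ) + p.2 = k := by exact_mod_cast hp'
        have e3 : (p.2 : ℝ) ≤ k := by exact_mod_cast (by omega : p.2 ≤ k)
        rw [div_mul_eq_mul_div, le_div_iff₀ (by positivity)]
        nlinarith)
      obtain ⟨s, hs⟩ : ∃ s, 2 * p.2 + k - l = 2 * s := ⟨(2 * p.2 + k - l) / 2, by omega⟩
      obtain ⟨a, ha⟩ : ∃ a, 2 * p.2 + l - k = 2 * a := ⟨(2 * p.2 + l - k) / 2, by omega⟩
      obtain ⟨b, hb⟩ : ∃ b, k + l - 2 * p.2 = 2 * b := ⟨(k + l - 2 * p.2) / 2, by omega⟩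
      rw [hs, ha, hb]
      simp only [Nat.mul_div_cancel_left _ (Nat.succ_pos 1)]
      have b2 := adamsCoeff_le_sqrt s a b (48 / (k + 1)) (by
        have e1 : (k : ℝ) + 1 ≤ 2 * (2 * a + 1) := by
          exact_mod_cast (by omega : k + 1 ≤ 2 * (2 * a + 1))
        have e2 : (k : ℝ) + 1 ≤ 2 * (2 * b + 1) := by
          exact_mod_cast (by omega : k + 1 ≤ 2 * (2 * b + 1))
        have e3 : (a : ℝ) + b + s ≤ 3 * k := by
          exact_mod_cast (by omega : a + b + s ≤ 3 * k)
        rw [div_mul_eq_mul_div, le_div_iff₀ (by positivity)]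
        have e4 : ((k : ℝ) + 1) * (k + 1) ≤ (2 * (2 * a + 1)) * (2 * (2 * b + 1)) :=
          mul_le_mul e1 e2 (by positivity) (by positivity)
        nlinarith)
      have hsqrt : √(32 / ((k : ℝ) + 1)) * √(48 / (k + 1)) ≤ 40 / (k + 1) := by
        rw [← Real.sqrt_mul (by positivity), div_mul_div_comm]
        refine Real.sqrt_le_iff.2 ⟨by positivity, ?_⟩
        rw [div_pow, ← sq]
        gcongr
        norm_num
      have p1 := normBinom_pos p.1
      have p2 := normBinom_pos s
      calc _ ≤ (normBinom p.1 * √(32 / (k + 1))) * (normBinom s * √(48 / (k + 1))) :=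
            mul_le_mul b1 b2 (adamsCoeff_nonneg _ _ _) (by positivity)
        _ = normBinom p.1 * normBinom s * (√(32 / ((k : ℝ) + 1)) * √(48 / (k + 1))) := by ring
        _ ≤ _ := mul_le_mul_of_nonneg_left hsqrt (by positivity)
    · rw [if_neg hc, mul_zero]
      have p1 := normBinom_pos p.1
      have p2 := normBinom_pos ((2 * p.2 + k - l) / 2)
      split_ifs <;> positivity
  refine (Finset.sum_le_sum hterm).trans ?_
  rw [← Finset.sum_filter, ← Finset.sum_mul]
  refine mul_le_of_le_one_left (by positivity) ?_
  rw [← sum_antidiagonal_normBinom ((3 * k - l) / 2)]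
  have hinj : Set.InjOn (fun p : ℕ × ℕ => (p.1, (2 * p.2 + k - l) / 2))
      ((Finset.HasAntidiagonal.antidiagonal k).filter
        fun p => k ≤ 2 * p.2 + l ∧ l ≤ 2 * p.2 + k ∧ Even (2 * p.2 + k + l)) := by
    intro p hp q hq h
    simp only [Finset.coe_filter, Set.mem_ofPred_eq, Finset.HasAntidiagonal.mem_antidiagonal,
      Prod.mk.injEq] at hp hq h
    ext <;> omega
  rw [← Finset.sum_image (f := fun q : ℕ × ℕ => normBinom q.1 * normBinom q.2) hinj]
  refine Finset.sum_le_sum_of_subset_of_nonneg ?_ fun q _ _ =>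
    mul_nonneg (normBinom_pos _).le (normBinom_pos _).le
  intro q hq
  simp only [Finset.mem_image, Finset.mem_filter, Finset.HasAntidiagonal.mem_antidiagonal] at hq ⊢
  obtain ⟨p, ⟨hp, h1, h2, e, he⟩, rfl⟩ := hq
  simp only
  omega

lemma exists_pow_eq_sum_legendreFun (N : ℕ) :
    ∃ q : ℕ → ℝ, ∀ t : ℝ, ((1 + t) / 2) ^ N = ∑ j ∈ Finset.range (N + 1), q j * legendreFun j t :=
      by
  induction N with
  | zero => exact ⟨fun _ => 1, fun t => by simp [legendreFun_zero]⟩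
  | succ N ih =>
    obtain ⟨q, hq⟩ := ih
    refine ⟨fun l => (∑ j ∈ Finset.range (N + 1), q j / 2 * legendreMulCoeff 1 j l) +
      if l < N + 1 then q l / 2 else 0, fun t => ?_⟩
    have h1 : ∀ j ∈ Finset.range (N + 1), t / 2 * (q j * legendreFun j t) =
        ∑ l ∈ Finset.range (N + 1 + 1), q j / 2 * legendreMulCoeff 1 j l * legendreFun l t := by
      intro j hj
      have hj' := Finset.mem_range.1 hj
      have := legendreFun_mul_eq_sum 1 j (N + 1 + 1) (by omega) t
      rw [legendreFun_one] at this
      simp_rw [mul_assoc, ← Finset.mul_sum, ← this]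
      ring
    simp_rw [add_mul, Finset.sum_add_distrib, Finset.sum_mul]
    rw [Finset.sum_comm, ← Finset.sum_congr rfl h1, ← Finset.mul_sum, ← hq,
      Finset.sum_range_succ _ (N + 1)]
    simp only [lt_irrefl, if_false, zero_mul, add_zero]
    have h2 : ∑ l ∈ Finset.range (N + 1), (if l < N + 1 then q l / 2 else 0) * legendreFun l t
        = ((1 + t) / 2) ^ N / 2 := by
      rw [hq, Finset.sum_div]
      refine Finset.sum_congr rfl fun l hl => ?_
      rw [if_pos (Finset.mem_range.1 hl)]
      ring
    rw [h2, pow_succ]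
    ring

/-- The Laplacian on polynomials in three variables. -/
noncomputable def polyLaplacian :
    MvPolynomial (Fin 3) ℂ →ₗ[ℂ] MvPolynomial (Fin 3) ℂ :=
  ∑ i : Fin 3, (pderiv i).toLinearMap ∘ₗ (pderiv i).toLinearMap

lemma polyLaplacian_apply (P : MvPolynomial (Fin 3) ℂ) :
    polyLaplacian P = ∑ i : Fin 3, pderiv i (pderiv i P) := by
  simp [polyLaplacian]

/-- Solid harmonic polynomials, homogeneous of degree `k`. -/
noncomputable def solidHarmonics (k : ℕ) : Submodule ℂ (MvPolynomial (Fin 3) ℂ) :=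
  homogeneousSubmodule (Fin 3) ℂ k ⊓ LinearMap.ker polyLaplacian

lemma mem_solidHarmonics {k : ℕ} {P : MvPolynomial (Fin 3) ℂ} :
    P ∈ solidHarmonics k ↔ P.IsHomogeneous k ∧ polyLaplacian P = 0 := by
  simp [solidHarmonics]

/-- The linear form `∑ aᵢ Xᵢ`. -/
noncomputable def linearForm (a : Fin 3 → ℂ) : MvPolynomial (Fin 3) ℂ :=
  ∑ i, C (a i) * X i

/-- The quadratic form `∑ Xᵢ²`. -/
noncomputable def radialSq : MvPolynomial (Fin 3) ℂ := ∑ i, X i ^ 2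

lemma polyLaplacian_linearForm_mul (a : Fin 3 → ℂ) (P : MvPolynomial (Fin 3) ℂ) :
    polyLaplacian (linearForm a * P) =
      2 * ∑ i, C (a i) * pderiv i P + linearForm a * polyLaplacian P := by
  simp only [polyLaplacian_apply, linearForm, Fin.sum_univ_three, pderiv_mul, map_add,
    pderiv_X_self, pderiv_X_of_ne, ne_eq, Fin.reduceEq, not_false_eq_true, pderiv_C, mul_zero,
    zero_mul, mul_one, pderiv_one, map_zero]
  ring

lemma polyLaplacian_radialSq_mul (P : MvPolynomial (Fin 3) ℂ) :
    polyLaplacian (radialSq * P) =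
      6 * P + 4 * ∑ i, X i * pderiv i P + radialSq * polyLaplacian P := by
  simp only [polyLaplacian_apply, radialSq, Fin.sum_univ_three, pderiv_mul, map_add, pow_two,
    pderiv_X_self, pderiv_X_of_ne, ne_eq, Fin.reduceEq, not_false_eq_true, mul_zero,
    zero_mul, mul_one, pderiv_one, map_zero]
  ring

/-- The zonal solid harmonics with axis `a`. -/
noncomputable def solidZonal (a : Fin 3 → ℂ) : ℕ → MvPolynomial (Fin 3) ℂ
  | 0 => 1
  | 1 => linearForm a
  | n + 2 => C ((2 * n + 3) / (n + 2) : ℂ) * (linearForm a * solidZonal a (n + 1)) -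
      C ((n + 1) / (n + 2) : ℂ) * (radialSq * solidZonal a n)

lemma isHomogeneous_linearForm (a : Fin 3 → ℂ) : (linearForm a).IsHomogeneous 1 := by
  refine IsHomogeneous.sum _ _ _ fun i _ => ?_
  simpa using (isHomogeneous_C (Fin 3) (a i)).mul (isHomogeneous_X ℂ i)

lemma isHomogeneous_radialSq : radialSq.IsHomogeneous 2 := by
  refine IsHomogeneous.sum _ _ _ fun i _ => ?_
  simpa using (isHomogeneous_X ℂ i).pow 2

lemma isHomogeneous_solidZonal (a : Fin 3 → ℂ) (n : ℕ) : (solidZonal a n).IsHomogeneous n := by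
  induction n using Nat.strong_induction_on with
  | _ n ih =>
    match n with
    | 0 => exact isHomogeneous_one _ _
    | 1 => exact isHomogeneous_linearForm a
    | n + 2 =>
      rw [solidZonal]
      refine IsHomogeneous.sub ?_ ?_
      · have := (isHomogeneous_C (Fin 3) ((2 * n + 3) / (n + 2) : ℂ)).mul
          ((isHomogeneous_linearForm a).mul (ih (n + 1) (by omega)))
        rwa [show 0 + (1 + (n + 1)) = n + 2 by omega] at this
      · have := (isHomogeneous_C (Fin 3) ((n + 1) / (n + 2) : ℂ)).mul
          (isHomogeneous_radialSq.mul (ih n (by omega)))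
        rwa [show 0 + (2 + n) = n + 2 by omega] at this

lemma sum_pderiv_linearForm_mul (a : Fin 3 → ℂ) (ha : ∑ i, a i ^ 2 = 1)
    (P : MvPolynomial (Fin 3) ℂ) :
    ∑ i, C (a i) * pderiv i (linearForm a * P) =
      P + linearForm a * ∑ i, C (a i) * pderiv i P := by
  have h : C (a 0) ^ 2 + C (a 1) ^ 2 + C (a 2) ^ 2 = (1 : MvPolynomial (Fin 3) ℂ) := by
    rw [← C_1, ← ha, Fin.sum_univ_three]; simp
  simp only [linearForm, Fin.sum_univ_three, pderiv_mul, map_add,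
    pderiv_X_self, pderiv_X_of_ne, ne_eq, Fin.reduceEq, not_false_eq_true, pderiv_C, mul_zero,
    zero_mul, mul_one]
  linear_combination P * h

lemma sum_pderiv_radialSq_mul (a : Fin 3 → ℂ) (P : MvPolynomial (Fin 3) ℂ) :
    ∑ i, C (a i) * pderiv i (radialSq * P) =
      2 * linearForm a * P + radialSq * ∑ i, C (a i) * pderiv i P := by
  simp only [linearForm, radialSq, Fin.sum_univ_three, pderiv_mul, map_add, pow_two,
    pderiv_X_self, pderiv_X_of_ne, ne_eq, Fin.reduceEq, not_false_eq_true, mul_zero,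
    zero_mul, mul_one]
  ring

/-- The derivative in the direction `a`. -/
noncomputable def dirDeriv (a : Fin 3 → ℂ) :
    Derivation ℂ (MvPolynomial (Fin 3) ℂ) (MvPolynomial (Fin 3) ℂ) :=
  ∑ i, a i • pderiv i

lemma dirDeriv_apply (a : Fin 3 → ℂ) (P : MvPolynomial (Fin 3) ℂ) :
    dirDeriv a P = ∑ i, C (a i) * pderiv i P := by
  simp only [dirDeriv, C_mul', Fin.sum_univ_three]
  rfl

lemma solidZonal_succ_succ (a : Fin 3 → ℂ) (n : ℕ) :
    (n + 2) • solidZonal a (n + 2) =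
      (2 * n + 3) • (linearForm a * solidZonal a (n + 1)) -
        (n + 1) • (radialSq * solidZonal a n) := by
  have hn : (n : ℂ) + 2 ≠ 0 := by norm_cast
  have k1 : ((n : ℂ) + 2) * ((2 * n + 3) / (n + 2)) = 2 * n + 3 := by field_simp
  have k2 : ((n : ℂ) + 2) * ((n + 1) / (n + 2)) = n + 1 := by field_simp
  rw [← Nat.cast_smul_eq_nsmul ℂ, ← Nat.cast_smul_eq_nsmul ℂ, ← Nat.cast_smul_eq_nsmul ℂ,
    solidZonal, C_mul', C_mul', smul_sub, smul_smul, smul_smul]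
  push_cast
  rw [k1, k2]

lemma dirDeriv_solidZonal_succ (a : Fin 3 → ℂ) (ha : ∑ i, a i ^ 2 = 1) (n : ℕ) :
    dirDeriv a (solidZonal a (n + 1)) = (n + 1) • solidZonal a n := by
  have h1 : dirDeriv a (linearForm a) = 1 := by
    simpa [dirDeriv_apply] using sum_pderiv_linearForm_mul a ha 1
  have hl (P) : dirDeriv a (linearForm a * P) = P + linearForm a * dirDeriv a P := by
    simpa only [dirDeriv_apply] using sum_pderiv_linearForm_mul a ha P
  have hr (P) : dirDeriv a (radialSq * P) = 2 * linearForm a * P + radialSq * dirDeriv a P := by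
    simpa only [dirDeriv_apply] using sum_pderiv_radialSq_mul a P
  have key (n : ℕ) : (n + 2) • dirDeriv a (solidZonal a (n + 2)) =
      (2 * n + 3) • (solidZonal a (n + 1) + linearForm a * dirDeriv a (solidZonal a (n + 1))) -
        (n + 1) • (2 * linearForm a * solidZonal a n
          + radialSq * dirDeriv a (solidZonal a n)) := by
    rw [← map_nsmul, solidZonal_succ_succ, map_sub, map_nsmul, map_nsmul, hl, hr]
  induction n using Nat.strong_induction_on with
  | _ n ih =>
    match n with
    | 0 => simpa [solidZonal] using h1
    | 1 =>
      have h := key 0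
      have h0 : dirDeriv a (1 : MvPolynomial (Fin 3) ℂ) = 0 := Derivation.map_one_eq_zero _
      simp only [solidZonal.eq_1, solidZonal.eq_2, zero_add, h1, h0] at h
      refine smul_right_injective _ (two_ne_zero (α := ℕ)) ?_
      simp only [nsmul_eq_mul] at h ⊢
      push_cast at h ⊢
      rw [h, solidZonal.eq_2]
      ring
    | n + 2 =>
      have e1 := ih (n + 1) (by omega)
      have e0 := ih n (by omega)
      have h := key (n + 1)
      have hz := solidZonal_succ_succ a n
      rw [e1, e0] at h
      refine smul_right_injective _ (show n + 3 ≠ 0 by omega) ?_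
      simp only [nsmul_eq_mul] at h hz ⊢
      push_cast at h hz ⊢
      have h' : ((n : MvPolynomial (Fin 3) ℂ) + 1 + 2) * dirDeriv a (solidZonal a (n + 2 + 1)) = _ := h
      linear_combination h' - (n + 2 : MvPolynomial (Fin 3) ℂ) * hz

lemma solidZonal_mem (a : Fin 3 → ℂ) (ha : ∑ i, a i ^ 2 = 1) (n : ℕ) :
    solidZonal a n ∈ solidHarmonics n := by
  refine mem_solidHarmonics.2 ⟨isHomogeneous_solidZonal a n, ?_⟩
  induction n using Nat.strong_induction_on with
  | _ n ih =>
    match n with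
    | 0 => simp [solidZonal, polyLaplacian_apply]
    | 1 =>
      have := polyLaplacian_linearForm_mul a 1
      simpa [solidZonal, polyLaplacian_apply] using this
    | n + 2 =>
      have e1 := ih (n + 1) (by omega)
      have e0 := ih n (by omega)
      refine smul_right_injective _ (show n + 2 ≠ 0 by omega) ?_
      simp only
      rw [← map_nsmul, solidZonal_succ_succ, map_sub, map_nsmul, map_nsmul,
        polyLaplacian_linearForm_mul, polyLaplacian_radialSq_mul, e1, e0, ← dirDeriv_apply,
        dirDeriv_solidZonal_succ a ha, (isHomogeneous_solidZonal a n).sum_X_mul_pderiv]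
      simp only [nsmul_eq_mul]
      push_cast
      ring

/-- The value of a polynomial at a point of the unit sphere. -/
noncomputable def sphereEval (P : MvPolynomial (Fin 3) ℂ)
    (x : sphere (0 : EuclideanSpace ℝ (Fin 3)) 1) : ℂ :=
  MvPolynomial.eval (fun i => ((x : EuclideanSpace ℝ (Fin 3)) i : ℂ)) P

lemma sum_sq_sphere (x : sphere (0 : EuclideanSpace ℝ (Fin 3)) 1) :
    ∑ i, (x : EuclideanSpace ℝ (Fin 3)) i ^ 2 = 1 := by
  have := EuclideanSpace.real_norm_sq_eq (x : EuclideanSpace ℝ (Fin 3))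
  rw [← this, norm_eq_of_mem_sphere, one_pow]

/-- The polynomial representing the zonal harmonic of degree `n` with pole `x`. -/
noncomputable def zonalAt (n : ℕ) (x : sphere (0 : EuclideanSpace ℝ (Fin 3)) 1) :
    MvPolynomial (Fin 3) ℂ :=
  solidZonal (fun i => ((x : EuclideanSpace ℝ (Fin 3)) i : ℂ)) n

lemma zonalAt_mem (n : ℕ) (x : sphere (0 : EuclideanSpace ℝ (Fin 3)) 1) :
    zonalAt n x ∈ solidHarmonics n :=
  solidZonal_mem _ (by exact_mod_cast sum_sq_sphere x) n

lemma sphereEval_linearForm (x y : sphere (0 : EuclideanSpace ℝ (Fin 3)) 1) :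
    sphereEval (linearForm fun i => ((x : EuclideanSpace ℝ (Fin 3)) i : ℂ)) y =
      ((inner ℝ (x : EuclideanSpace ℝ (Fin 3)) y : ℝ) : ℂ) := by
  simp only [sphereEval, linearForm, map_sum, map_mul, eval_C, eval_X, PiLp.inner_apply]
  push_cast
  exact Finset.sum_congr rfl fun i _ => by simp [mul_comm]

lemma sphereEval_radialSq (y : sphere (0 : EuclideanSpace ℝ (Fin 3)) 1) :
    sphereEval radialSq y = 1 := by
  simp only [sphereEval, radialSq, map_sum, map_pow, eval_X]
  exact_mod_cast sum_sq_sphere y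

lemma sphereEval_zonalAt (n : ℕ) (x y : sphere (0 : EuclideanSpace ℝ (Fin 3)) 1) :
    sphereEval (zonalAt n x) y =
      (legendreFun n (inner ℝ (x : EuclideanSpace ℝ (Fin 3)) y) : ℂ) := by
  induction n using Nat.strong_induction_on with
  | _ n ih =>
    match n with
    | 0 => simp [zonalAt, solidZonal, sphereEval, legendreFun_zero]
    | 1 => rw [zonalAt, solidZonal, sphereEval_linearForm, legendreFun_one]
    | n + 2 =>
      have e1 := ih (n + 1) (by omega)
      have e0 := ih n (by omega)
      have hL := sphereEval_linearForm x y
      have hR := sphereEval_radialSq y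
      have hrec := legendreFun_succ_succ n (inner ℝ (x : EuclideanSpace ℝ (Fin 3)) y)
      have hn : (n : ℂ) + 2 ≠ 0 := by norm_cast
      have hrec' := congrArg (fun t : ℝ => (t : ℂ)) hrec
      push_cast at hrec'
      simp only [zonalAt, sphereEval, solidZonal, map_sub, map_mul, eval_C] at e1 e0 hL hR ⊢
      rw [e1, e0, hL, hR]
      field_simp
      rw [mul_comm] 
      linear_combination -hrec'

instance : IsFiniteMeasure sphereMeasure := by
  unfold sphereMeasure; infer_instance

instance : sphereMeasure.IsOpenPosMeasure := by
  unfold sphereMeasure; infer_instance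

lemma continuous_sphereEval (P : MvPolynomial (Fin 3) ℂ) : Continuous (sphereEval P) := by
  unfold sphereEval
  have h : Continuous fun v : Fin 3 → ℂ => MvPolynomial.eval v P := MvPolynomial.continuous_eval P
  refine h.comp (continuous_pi fun i => ?_)
  fun_prop

lemma Continuous.integrable_sphereMeasure {f : sphere (0 : EuclideanSpace ℝ (Fin 3)) 1 → ℂ}
    (hf : Continuous f) : Integrable f sphereMeasure :=
  hf.integrable_of_hasCompactSupport (HasCompactSupport.of_compactSpace f)

/-- The action of a linear isometry on the unit sphere. -/
noncomputable def sphereIsometry (T : EuclideanSpace ℝ (Fin 3) ≃ₗᵢ[ℝ] EuclideanSpace ℝ (Fin 3))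
    (x : sphere (0 : EuclideanSpace ℝ (Fin 3)) 1) : sphere (0 : EuclideanSpace ℝ (Fin 3)) 1 :=
  ⟨T x, by simp⟩

open scoped Pointwise in
lemma measurePreserving_sphereIsometry
    (T : EuclideanSpace ℝ (Fin 3) ≃ₗᵢ[ℝ] EuclideanSpace ℝ (Fin 3)) :
    MeasurePreserving (sphereIsometry T) sphereMeasure sphereMeasure := by
  have hc : Continuous (sphereIsometry T) := by unfold sphereIsometry; fun_prop
  refine ⟨hc.measurable, ?_⟩
  ext s hs
  rw [Measure.map_apply hc.measurable hs, sphereMeasure,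
    Measure.toSphere_apply' _ (hc.measurable hs), Measure.toSphere_apply' _ hs,
    ← (T.measurePreserving).measure_preimage_equiv (f := T.toMeasurableEquiv)
      (Set.Ioo (0 : ℝ) 1 • (Subtype.val '' s))]
  congr 2
  ext v
  simp only [Set.mem_smul, Set.mem_image, Set.mem_preimage]
  constructor
  · rintro ⟨r, hr, _, ⟨x, hx, rfl⟩, rfl⟩
    exact ⟨r, hr, _, ⟨_, hx, rfl⟩, by simp [sphereIsometry]⟩
  · rintro ⟨r, hr, _, ⟨x, hx, rfl⟩, h⟩
    refine ⟨r, hr, _, ⟨sphereIsometry T.symm x, ?_, rfl⟩, ?_⟩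
    · simpa [sphereIsometry] using hx
    · apply T.injective
      simpa [sphereIsometry] using h

/-- Rotation by the angle `θ` about the `i`-th coordinate axis. -/
noncomputable def rotationLinear (i : Fin 3) (θ : ℝ) :
    EuclideanSpace ℝ (Fin 3) →ₗ[ℝ] EuclideanSpace ℝ (Fin 3) where
  toFun x := WithLp.toLp 2 fun j =>
    if j = i then x i else if j = i + 1 then Real.cos θ * x (i + 1) - Real.sin θ * x (i + 2)
      else Real.sin θ * x (i + 1) + Real.cos θ * x (i + 2)
  map_add' x y := by
    ext j
    simp only [PiLp.add_apply]
    split_ifs <;> ring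
  map_smul' c x := by
    ext j
    simp only [PiLp.smul_apply, smul_eq_mul, RingHom.id_apply]
    split_ifs <;> ring

/-- Rotation about a coordinate axis as a linear isometry. -/
noncomputable def axisRotation (i : Fin 3) (θ : ℝ) :
    EuclideanSpace ℝ (Fin 3) ≃ₗᵢ[ℝ] EuclideanSpace ℝ (Fin 3) :=
  LinearIsometry.toLinearIsometryEquiv
    { rotationLinear i θ with
      norm_map' := fun x => by
        rw [EuclideanSpace.norm_eq, EuclideanSpace.norm_eq]
        congr 1
        have h := Real.sin_sq_add_cos_sq θ
        fin_cases i <;>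
        · simp [rotationLinear, Fin.sum_univ_three]
          first
          | linear_combination (x.ofLp 1 ^ 2 + x.ofLp 2 ^ 2) * h
          | linear_combination (x.ofLp 2 ^ 2 + x.ofLp 0 ^ 2) * h
          | linear_combination (x.ofLp 0 ^ 2 + x.ofLp 1 ^ 2) * h } rfl

lemma hasDerivAt_eval_path (P : MvPolynomial (Fin 3) ℂ) {γ : ℝ → Fin 3 → ℂ} {γ' : Fin 3 → ℂ}
    {θ : ℝ} (h : ∀ i, HasDerivAt (fun t => γ t i) (γ' i) θ) :
    HasDerivAt (fun t => MvPolynomial.eval (γ t) P)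
      (∑ i, γ' i * MvPolynomial.eval (γ θ) (pderiv i P)) θ := by
  induction P using MvPolynomial.induction_on with
  | C a => simpa using hasDerivAt_const θ a
  | add p q hp hq =>
    simp only [map_add, mul_add, Finset.sum_add_distrib]
    exact hp.add hq
  | mul_X p j hp =>
    simp only [map_mul, eval_X, pderiv_mul, map_add, mul_add, Finset.sum_add_distrib]
    refine (hp.mul (h j)).congr_deriv ?_
    rw [Finset.sum_mul]
    congr 1
    · exact Finset.sum_congr rfl fun i _ => by ring
    · rw [Finset.sum_eq_single j]
      · simp [mul_comm]
      · intro i _ hij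
        simp [pderiv_X_of_ne hij.symm]
      · simp

/-- The infinitesimal rotation about the `i`-th coordinate axis, acting on polynomials. -/
noncomputable def rotDeriv (i : Fin 3) :
    Derivation ℂ (MvPolynomial (Fin 3) ℂ) (MvPolynomial (Fin 3) ℂ) :=
  (X (i + 1) : MvPolynomial (Fin 3) ℂ) • pderiv (i + 2) -
    (X (i + 2) : MvPolynomial (Fin 3) ℂ) • pderiv (i + 1)

lemma rotDeriv_apply (i : Fin 3) (P : MvPolynomial (Fin 3) ℂ) :
    rotDeriv i P = X (i + 1) * pderiv (i + 2) P - X (i + 2) * pderiv (i + 1) P := rfl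

lemma axisRotation_apply (i : Fin 3) (θ : ℝ) (x : EuclideanSpace ℝ (Fin 3)) (j : Fin 3) :
    axisRotation i θ x j = if j = i then x i
      else if j = i + 1 then Real.cos θ * x (i + 1) - Real.sin θ * x (i + 2)
      else Real.sin θ * x (i + 1) + Real.cos θ * x (i + 2) := rfl

lemma hasDerivAt_sphereEval_rotation (i : Fin 3) (P : MvPolynomial (Fin 3) ℂ)
    (x : sphere (0 : EuclideanSpace ℝ (Fin 3)) 1) (θ : ℝ) :
    HasDerivAt (fun t => sphereEval P (sphereIsometry (axisRotation i t) x))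
      (sphereEval (rotDeriv i P) (sphereIsometry (axisRotation i θ) x)) θ := by
  have hs := Real.hasDerivAt_sin θ
  have hc := Real.hasDerivAt_cos θ
  set v : EuclideanSpace ℝ (Fin 3) := (x : EuclideanSpace ℝ (Fin 3))
  have h1 : HasDerivAt (fun t => Real.cos t * v (i + 1) - Real.sin t * v (i + 2))
      (-(Real.sin θ * v (i + 1) + Real.cos θ * v (i + 2))) θ := by
    refine ((hc.mul_const (v (i + 1))).sub (hs.mul_const (v (i + 2)))).congr_deriv ?_
    ring
  have h2 : HasDerivAt (fun t => Real.sin t * v (i + 1) + Real.cos t * v (i + 2))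
      (Real.cos θ * v (i + 1) - Real.sin θ * v (i + 2)) θ := by
    refine ((hs.mul_const (v (i + 1))).add (hc.mul_const (v (i + 2)))).congr_deriv ?_
    ring
  have key := hasDerivAt_eval_path P (θ := θ)
    (γ := fun t j => ((axisRotation i t v j : ℝ) : ℂ))
    (γ' := fun j => (((if j = i then 0
      else if j = i + 1 then -(Real.sin θ * v (i + 1) + Real.cos θ * v (i + 2))
      else Real.cos θ * v (i + 1) - Real.sin θ * v (i + 2)) : ℝ) : ℂ)) (by
      intro j
      refine HasDerivAt.ofReal_comp ?_
      simp only [axisRotation_apply]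
      split_ifs
      · exact hasDerivAt_const _ _
      · exact h1
      · exact h2)
  have e : ∀ t, sphereEval P (sphereIsometry (axisRotation i t) x) =
      MvPolynomial.eval (fun j => ((axisRotation i t v j : ℝ) : ℂ)) P := fun t => rfl
  simp only [e]
  convert key using 1
  simp only [sphereEval, rotDeriv_apply, map_sub, map_mul, eval_X, sphereIsometry,
    axisRotation_apply]
  fin_cases i <;> simp [Fin.sum_univ_three] <;> ring

lemma continuous_rotation_sphere (i : Fin 3) :
    Continuous fun q : ℝ × sphere (0 : EuclideanSpace ℝ (Fin 3)) 1 =>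
      sphereIsometry (axisRotation i q.1) q.2 := by
  refine Continuous.subtype_mk ?_ _
  refine (PiLp.continuous_toLp 2 _).comp (continuous_pi fun j => ?_)
  split_ifs <;> fun_prop

lemma integral_rotDeriv (i : Fin 3) (P : MvPolynomial (Fin 3) ℂ) :
    ∫ x, sphereEval (rotDeriv i P) x ∂sphereMeasure = 0 := by
  have hinv (θ : ℝ) : ∫ x, sphereEval (rotDeriv i P) (sphereIsometry (axisRotation i θ) x)
      ∂sphereMeasure = ∫ x, sphereEval (rotDeriv i P) x ∂sphereMeasure := by
    have hmp := measurePreserving_sphereIsometry (axisRotation i θ)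
    rw [← integral_map hmp.measurable.aemeasurable, hmp.map_eq]
    exact (continuous_sphereEval _).aestronglyMeasurable
  have hcont := (continuous_sphereEval (rotDeriv i P)).comp (continuous_rotation_sphere i)
  have : IsFiniteMeasure (volume.restrict (Set.uIoc 0 (2 * Real.pi))) := by
    rw [Set.uIoc]; infer_instance
  have hswap := intervalIntegral_integral_swap (μ := sphereMeasure) (a := 0) (b := 2 * Real.pi)
    (f := fun θ x => sphereEval (rotDeriv i P) (sphereIsometry (axisRotation i θ) x)) (by
      obtain ⟨M, hM⟩ := isCompact_univ.exists_bound_of_continuousOn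
        (continuous_sphereEval (rotDeriv i P)).continuousOn
      exact Integrable.of_bound hcont.aestronglyMeasurable M
        (Filter.Eventually.of_forall fun q => hM _ (Set.mem_univ _)))
  have hzero (x) : ∫ θ in (0 : ℝ)..(2 * Real.pi),
      sphereEval (rotDeriv i P) (sphereIsometry (axisRotation i θ) x) = 0 := by
    rw [intervalIntegral.integral_eq_sub_of_hasDerivAt
      (fun θ _ => hasDerivAt_sphereEval_rotation i P x θ)
      ((hcont.comp (by fun_prop : Continuous fun θ : ℝ => (θ, x))).intervalIntegrable _ _)]
    have : sphereIsometry (axisRotation i (2 * Real.pi)) x = sphereIsometry (axisRotation i 0) x :=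
      by
      ext j
      simp [sphereIsometry, axisRotation_apply]
    rw [this, sub_self]
  simp only [hinv, hzero, integral_zero, intervalIntegral.integral_const, sub_zero] at hswap
  exact (smul_eq_zero.1 hswap).resolve_left (by positivity)

lemma sphereEval_add (P Q : MvPolynomial (Fin 3) ℂ) (x : sphere (0 : EuclideanSpace ℝ (Fin 3)) 1) :
    sphereEval (P + Q) x = sphereEval P x + sphereEval Q x := map_add _ _ _

lemma sphereEval_mul (P Q : MvPolynomial (Fin 3) ℂ) (x : sphere (0 : EuclideanSpace ℝ (Fin 3)) 1) :
    sphereEval (P * Q) x = sphereEval P x * sphereEval Q x := map_mul _ _ _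

lemma sphereEval_smul (c : ℂ) (P : MvPolynomial (Fin 3) ℂ)
    (x : sphere (0 : EuclideanSpace ℝ (Fin 3)) 1) :
    sphereEval (c • P) x = c * sphereEval P x := by simp [sphereEval]

lemma sphereEval_map_conj (P : MvPolynomial (Fin 3) ℂ)
    (x : sphere (0 : EuclideanSpace ℝ (Fin 3)) 1) :
    sphereEval (map (starRingEnd ℂ) P) x = starRingEnd ℂ (sphereEval P x) := by
  induction P using MvPolynomial.induction_on with
  | C a => simp [sphereEval]
  | add p q hp hq => simp only [map_add, sphereEval_add, hp, hq]
  | mul_X p i hp => simp only [map_mul, sphereEval_mul, hp, map_X]; simp [sphereEval]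

lemma rotDeriv_map_conj (i : Fin 3) (P : MvPolynomial (Fin 3) ℂ) :
    rotDeriv i (map (starRingEnd ℂ) P) = map (starRingEnd ℂ) (rotDeriv i P) := by
  simp [rotDeriv_apply, pderiv_map]

/-- The `L²(S²)` inner product of (restrictions of) polynomials. -/
noncomputable def sphereInner (P Q : MvPolynomial (Fin 3) ℂ) : ℂ :=
  ∫ x, starRingEnd ℂ (sphereEval P x) * sphereEval Q x ∂sphereMeasure

lemma integrable_sphereInner (P Q : MvPolynomial (Fin 3) ℂ) :
    Integrable (fun x => starRingEnd ℂ (sphereEval P x) * sphereEval Q x) sphereMeasure :=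
  ((Complex.continuous_conj.comp (continuous_sphereEval P)).mul
    (continuous_sphereEval Q)).integrable_sphereMeasure

lemma sphereInner_add_right (P Q R : MvPolynomial (Fin 3) ℂ) :
    sphereInner P (Q + R) = sphereInner P Q + sphereInner P R := by
  simp only [sphereInner, sphereEval_add, mul_add]
  exact integral_add (integrable_sphereInner P Q) (integrable_sphereInner P R)

lemma sphereInner_smul_right (c : ℂ) (P Q : MvPolynomial (Fin 3) ℂ) :
    sphereInner P (c • Q) = c * sphereInner P Q := by
  simp only [sphereInner, sphereEval_smul, ← integral_const_mul]
  exact integral_congr_ae (Filter.Eventually.of_forall fun x => by ring)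

lemma sphereInner_conj_symm (P Q : MvPolynomial (Fin 3) ℂ) :
    starRingEnd ℂ (sphereInner Q P) = sphereInner P Q := by
  simp only [sphereInner, ← integral_conj]
  exact integral_congr_ae (Filter.Eventually.of_forall fun x => by simp [mul_comm])

lemma sphereInner_add_left (P Q R : MvPolynomial (Fin 3) ℂ) :
    sphereInner (P + Q) R = sphereInner P R + sphereInner Q R := by
  rw [← sphereInner_conj_symm, sphereInner_add_right, map_add, sphereInner_conj_symm,
    sphereInner_conj_symm]

lemma sphereInner_smul_left (c : ℂ) (P Q : MvPolynomial (Fin 3) ℂ) :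
    sphereInner (c • P) Q = starRingEnd ℂ c * sphereInner P Q := by
  rw [← sphereInner_conj_symm, sphereInner_smul_right, map_mul, sphereInner_conj_symm]

/-- `sphereInner P` as a linear functional. -/
noncomputable def sphereInnerLin (P : MvPolynomial (Fin 3) ℂ) :
    MvPolynomial (Fin 3) ℂ →ₗ[ℂ] ℂ where
  toFun := sphereInner P
  map_add' := sphereInner_add_right P
  map_smul' c Q := sphereInner_smul_right c P Q

lemma sphereInner_sum_right {ι : Type*} (s : Finset ι) (P : MvPolynomial (Fin 3) ℂ)
    (Q : ι → MvPolynomial (Fin 3) ℂ) :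
    sphereInner P (∑ i ∈ s, Q i) = ∑ i ∈ s, sphereInner P (Q i) :=
  map_sum (sphereInnerLin P) _ _

lemma sphereInner_self (P : MvPolynomial (Fin 3) ℂ) :
    sphereInner P P = ((∫ x, ‖sphereEval P x‖ ^ 2 ∂sphereMeasure : ℝ) : ℂ) := by
  rw [← integral_complex_ofReal]
  refine integral_congr_ae (Filter.Eventually.of_forall fun x => ?_)
  simp [Complex.conj_mul']

lemma sphereInner_rotDeriv_left (i : Fin 3) (P Q : MvPolynomial (Fin 3) ℂ) :
    sphereInner (rotDeriv i P) Q = -sphereInner P (rotDeriv i Q) := by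
  have h := integral_rotDeriv i (map (starRingEnd ℂ) P * Q)
  rw [Derivation.leibniz, rotDeriv_map_conj] at h
  simp only [smul_eq_mul, sphereEval_add, sphereEval_mul, sphereEval_map_conj] at h
  rw [integral_add (integrable_sphereInner _ _)] at h
  · rw [eq_neg_iff_add_eq_zero, add_comm, ← h]
    simp only [sphereInner]
    congr 1
    exact integral_congr_ae (Filter.Eventually.of_forall fun x => by ring)
  · exact ((continuous_sphereEval Q).mul
      (Complex.continuous_conj.comp (continuous_sphereEval _))).integrable_sphereMeasure

lemma pderiv_comm (a b : Fin 3) (P : MvPolynomial (Fin 3) ℂ) :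
    pderiv a (pderiv b P) = pderiv b (pderiv a P) := by
  let D (i : Fin 3) : Derivation ℂ (MvPolynomial (Fin 3) ℂ) (MvPolynomial (Fin 3) ℂ) := pderiv i
  have h : ⁅D a, D b⁆ = 0 := by
    refine MvPolynomial.derivation_ext fun i => ?_
    rw [Derivation.commutator_apply, pderiv_X, pderiv_X]
    simp only [Pi.single_apply]
    split_ifs <;> simp
  have := congrArg (fun D => D P) h
  rwa [Derivation.commutator_apply, Derivation.zero_apply, sub_eq_zero] at this

lemma polyLaplacian_rotDeriv (i : Fin 3) (P : MvPolynomial (Fin 3) ℂ) :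
    polyLaplacian (rotDeriv i P) = rotDeriv i (polyLaplacian P) := by
  fin_cases i <;>
  · simp only [polyLaplacian_apply, rotDeriv_apply, Fin.sum_univ_three, pderiv_mul, map_add,
      map_sub, pderiv_X_self, pderiv_X_of_ne, ne_eq, Fin.reduceEq, not_false_eq_true, zero_mul,
      one_mul, pderiv_one, Fin.reduceAdd, Fin.isValue, Fin.zero_eta, Fin.mk_one, Fin.reduceFinMk,
      map_zero, zero_add, pderiv_comm 1 0, pderiv_comm 2 0, pderiv_comm 2 1]
    ring

lemma isHomogeneous_rotDeriv (i : Fin 3) {k : ℕ} {P : MvPolynomial (Fin 3) ℂ}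
    (hP : P.IsHomogeneous k) : (rotDeriv i P).IsHomogeneous k := by
  rcases k with _ | k
  · rw [← totalDegree_zero_iff_isHomogeneous, totalDegree_eq_zero_iff_eq_C] at hP
    rw [hP, rotDeriv_apply, pderiv_C, pderiv_C, mul_zero, mul_zero, sub_zero]
    exact isHomogeneous_zero _ _ _
  · rw [rotDeriv_apply, add_comm k]
    exact ((isHomogeneous_X ℂ _).mul hP.pderiv).sub ((isHomogeneous_X ℂ _).mul hP.pderiv)

lemma rotDeriv_mem (i : Fin 3) {k : ℕ} {P : MvPolynomial (Fin 3) ℂ}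
    (hP : P ∈ solidHarmonics k) : rotDeriv i P ∈ solidHarmonics k := by
  rw [mem_solidHarmonics] at hP ⊢
  exact ⟨isHomogeneous_rotDeriv i hP.1, by rw [polyLaplacian_rotDeriv, hP.2, map_zero]⟩

lemma casimir {k : ℕ} {P : MvPolynomial (Fin 3) ℂ} (hP : P ∈ solidHarmonics k) :
    ∑ i, rotDeriv i (rotDeriv i P) = -((k * (k + 1)) • P) := by
  rw [mem_solidHarmonics] at hP
  have h1 := hP.1.sum_X_mul_pderiv
  have h2 : ∑ i : Fin 3, X i * pderiv i (∑ j : Fin 3, X j * pderiv j P) =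
      ∑ i : Fin 3, X i * pderiv i (k • P) := by rw [h1]
  have h3 := hP.2
  rw [polyLaplacian_apply] at h3
  simp only [Fin.sum_univ_three, rotDeriv_apply, pderiv_mul, map_add, map_sub, pderiv_X_self,
    pderiv_X_of_ne, ne_eq, Fin.reduceEq, not_false_eq_true, zero_mul, one_mul, Fin.reduceAdd,
    Fin.isValue, zero_add, pderiv_comm 1 0, pderiv_comm 2 0, pderiv_comm 2 1,
    nsmul_eq_mul, Derivation.map_natCast] at h1 h2 h3 ⊢
  push_cast at h1 h2 h3 ⊢
  linear_combination (X 0 ^ 2 + X 1 ^ 2 + X 2 ^ 2) * h3 - h2 - (k + 1 : MvPolynomial (Fin 3) ℂ) * h1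

lemma sum_sphereInner_rotDeriv {k : ℕ} {P : MvPolynomial (Fin 3) ℂ} (hP : P ∈ solidHarmonics k)
    (Q : MvPolynomial (Fin 3) ℂ) :
    ∑ i, sphereInner (rotDeriv i Q) (rotDeriv i P) = (k * (k + 1)) * sphereInner Q P := by
  simp only [sphereInner_rotDeriv_left, Finset.sum_neg_distrib, ← sphereInner_sum_right,
    casimir hP]
  rw [← Nat.cast_smul_eq_nsmul ℂ, ← neg_smul,
    sphereInner_smul_right]
  push_cast
  ring

lemma sphereInner_eq_zero_of_ne {j k : ℕ} (hjk : j ≠ k) {P Q : MvPolynomial (Fin 3) ℂ}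
    (hP : P ∈ solidHarmonics j) (hQ : Q ∈ solidHarmonics k) : sphereInner P Q = 0 := by
  have h1 := sum_sphereInner_rotDeriv hQ P
  have h2 := congrArg (starRingEnd ℂ) (sum_sphereInner_rotDeriv hP Q)
  simp only [map_sum, map_mul, map_add, map_one, map_natCast, sphereInner_conj_symm] at h2
  have h : ((j : ℂ) * (j + 1) - k * (k + 1)) * sphereInner P Q = 0 := by
    linear_combination h1 - h2
  refine (mul_eq_zero.1 h).resolve_left fun h0 => hjk ?_
  have h0' : j * (j + 1) = k * (k + 1) := by exact_mod_cast sub_eq_zero.1 h0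
  rcases lt_trichotomy j k with h | h | h
  · nlinarith
  · exact h
  · nlinarith

/-- The unit sphere in `ℝ³`. -/
abbrev UnitSphere := sphere (0 : EuclideanSpace ℝ (Fin 3)) 1

/-- The Euclidean inner product of two points of the sphere. -/
noncomputable def sphereDot (x y : UnitSphere) : ℝ :=
  inner ℝ (x : EuclideanSpace ℝ (Fin 3)) y

lemma sphereDot_comm (x y : UnitSphere) : sphereDot x y = sphereDot y x :=
  real_inner_comm _ _

lemma sphereDot_self (x : UnitSphere) : sphereDot x x = 1 := by
  rw [sphereDot, real_inner_self_eq_norm_sq, norm_eq_of_mem_sphere, one_pow]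

lemma abs_sphereDot_le (x y : UnitSphere) : |sphereDot x y| ≤ 1 := by
  have := abs_real_inner_le_norm (x : EuclideanSpace ℝ (Fin 3)) y
  simpa [sphereDot] using this

lemma sphereDot_lt_one {x y : UnitSphere} (h : y ≠ x) : sphereDot x y < 1 := by
  refine lt_of_le_of_ne (abs_le.1 (abs_sphereDot_le x y)).2 fun h1 => h ?_
  exact (Subtype.ext ((inner_eq_one_iff_of_norm_eq_one (𝕜 := ℝ) (norm_eq_of_mem_sphere x)
    (norm_eq_of_mem_sphere y)).1 h1)).symm

lemma continuous_sphereDot : Continuous fun q : UnitSphere × UnitSphere => sphereDot q.1 q.2 := by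
  unfold sphereDot
  fun_prop

lemma continuous_sphereDot_right (x : UnitSphere) : Continuous (sphereDot x) :=
  continuous_sphereDot.comp (Continuous.prodMk_right x)

lemma sphereEval_zonalAt' (n : ℕ) (x y : UnitSphere) :
    sphereEval (zonalAt n x) y = (legendreFun n (sphereDot x y) : ℂ) :=
  sphereEval_zonalAt n x y

lemma Continuous.integrable_sphereMeasure_real {f : UnitSphere → ℝ}
    (hf : Continuous f) : Integrable f sphereMeasure :=
  hf.integrable_of_hasCompactSupport (HasCompactSupport.of_compactSpace f)

lemma continuous_legendre_sphereDot (n : ℕ) (x : UnitSphere) :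
    Continuous fun y => legendreFun n (sphereDot x y) :=
  (continuous_legendreFun n).comp (continuous_sphereDot_right x)

/-- The total area of the sphere. -/
noncomputable def sphereArea : ℝ := sphereMeasure.real Set.univ

lemma sphereArea_pos : 0 < sphereArea := by
  have : sphereMeasure ≠ 0 := by
    unfold sphereMeasure
    exact Measure.toSphere_ne_zero _
  have : NeZero sphereMeasure := ⟨this⟩
  exact measureReal_univ_pos

lemma integral_legendre_mul_eq_zero {j k : ℕ} (hjk : j ≠ k) {F : MvPolynomial (Fin 3) ℂ}
    (hF : F ∈ solidHarmonics k) (x : UnitSphere) :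
    ∫ y, (legendreFun j (sphereDot x y) : ℂ) * sphereEval F y ∂sphereMeasure = 0 := by
  have := sphereInner_eq_zero_of_ne hjk (zonalAt_mem j x) hF
  simpa [sphereInner, sphereEval_zonalAt'] using this

lemma integral_legendre_mul_legendre {j k : ℕ} (hjk : j ≠ k) (x : UnitSphere) :
    ∫ y, legendreFun j (sphereDot x y) * legendreFun k (sphereDot x y) ∂sphereMeasure = 0 := by
  have := integral_legendre_mul_eq_zero hjk (zonalAt_mem k x) x
  simp only [sphereEval_zonalAt'] at this
  have h2 : ((∫ y, legendreFun j (sphereDot x y) * legendreFun k (sphereDot x y)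
      ∂sphereMeasure : ℝ) : ℂ) = 0 := by
    rw [← integral_complex_ofReal, ← this]
    simp
  exact_mod_cast h2

lemma integral_legendre_sq (k : ℕ) (x : UnitSphere) :
    ∫ y, legendreFun k (sphereDot x y) ^ 2 ∂sphereMeasure = sphereArea / (2 * k + 1) := by
  induction k with
  | zero => simp [legendreFun_zero, sphereArea]
  | succ n ih =>
    have hint (a b : ℕ) : Integrable
        (fun y => legendreFun a (sphereDot x y) * legendreFun b (sphereDot x y)) sphereMeasure :=
      ((continuous_legendre_sphereDot a x).mul
        (continuous_legendre_sphereDot b x)).integrable_sphereMeasure_real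
    have h1 : ∫ y, sphereDot x y * legendreFun (n + 1) (sphereDot x y)
        * legendreFun n (sphereDot x y) ∂sphereMeasure =
        ((n : ℝ) + 1) / (2 * n + 3) * (sphereArea / (2 * n + 1)) := by
      have e (y) : sphereDot x y * legendreFun (n + 1) (sphereDot x y)
          * legendreFun n (sphereDot x y) =
          ((n : ℝ) + 2) / (2 * n + 3) *
            (legendreFun (n + 2) (sphereDot x y) * legendreFun n (sphereDot x y)) +
          ((n : ℝ) + 1) / (2 * n + 3) *
            (legendreFun n (sphereDot x y) * legendreFun n (sphereDot x y)) := by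
        rw [mul_legendreFun_succ]; ring
      simp only [e]
      rw [integral_add ((hint _ _).const_mul _) ((hint _ _).const_mul _), integral_const_mul,
        integral_const_mul, integral_legendre_mul_legendre (by omega)]
      simp only [← pow_two, ih]
      ring
    have h2 : ∫ y, sphereDot x y * legendreFun (n + 1) (sphereDot x y)
        * legendreFun n (sphereDot x y) ∂sphereMeasure =
        ((n : ℝ) + 1) / (2 * n + 1) *
          ∫ y, legendreFun (n + 1) (sphereDot x y) ^ 2 ∂sphereMeasure := by
      rcases n with _ | n
      · simp only [legendreFun_zero, legendreFun_one, zero_add]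
        simp [pow_two]
      · have e (y) : sphereDot x y * legendreFun (n + 1 + 1) (sphereDot x y)
            * legendreFun (n + 1) (sphereDot x y) =
            ((n : ℝ) + 2) / (2 * n + 3) *
              (legendreFun (n + 2) (sphereDot x y) * legendreFun (n + 2) (sphereDot x y)) +
            ((n : ℝ) + 1) / (2 * n + 3) *
              (legendreFun n (sphereDot x y) * legendreFun (n + 2) (sphereDot x y)) := by
          rw [mul_right_comm, mul_legendreFun_succ]; ring
        simp only [e]
        rw [integral_add ((hint _ _).const_mul _) ((hint _ _).const_mul _), integral_const_mul,
          integral_const_mul, integral_legendre_mul_legendre (j := n) (by omega)]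
        simp only [← pow_two]
        push_cast
        ring
    have h3 := h1.symm.trans h2
    have p1 : (2 * (n : ℝ) + 3) ≠ 0 := by positivity
    have p2 : (2 * (n : ℝ) + 1) ≠ 0 := by positivity
    have p3 : ((n : ℝ) + 1) ≠ 0 := by positivity
    field_simp at h3
    push_cast
    rw [eq_div_iff (by positivity)]
    linear_combination -h3

/-- The normalizing constant `(2 * k + 1) / |S²|` of the zonal reproducing kernel. -/
noncomputable def zonalConst (k : ℕ) : ℝ := (2 * k + 1) / sphereArea

lemma zonalConst_pos (k : ℕ) : 0 < zonalConst k := div_pos (by positivity) sphereArea_pos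

/-- The reproducing kernel of the spherical harmonics of degree `k`. -/
noncomputable def zonalKernel (k : ℕ) (x y : UnitSphere) : ℝ :=
  zonalConst k * legendreFun k (sphereDot x y)

lemma zonalKernel_comm (k : ℕ) (x y : UnitSphere) : zonalKernel k x y = zonalKernel k y x := by
  rw [zonalKernel, sphereDot_comm, zonalKernel]

lemma continuous_zonalKernel (k : ℕ) :
    Continuous fun q : UnitSphere × UnitSphere => zonalKernel k q.1 q.2 :=
  ((continuous_legendreFun k).comp continuous_sphereDot).const_mul _

lemma exists_tendsto_integral_legendre (k : ℕ) (x : UnitSphere) :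
    ∃ r : ℕ → ℝ, ∀ F ∈ solidHarmonics k,
      Filter.Tendsto (fun N => (r N : ℂ) *
        ∫ y, (legendreFun k (sphereDot x y) : ℂ) * sphereEval F y ∂sphereMeasure)
        Filter.atTop (nhds (sphereEval F x)) := by
  choose q hq using exists_pow_eq_sum_legendreFun
  refine ⟨fun N => (∫ y, ((1 + sphereDot x y) / 2) ^ N ∂sphereMeasure)⁻¹ * q N k, fun F hF => ?_⟩
  have hpeak := tendsto_setIntegral_pow_smul_of_unique_maximum_of_isCompact_of_continuousOn
    (μ := sphereMeasure) (s := Set.univ) (x₀ := x) (c := fun y => (1 + sphereDot x y) / 2)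
    (g := sphereEval F) isCompact_univ
    ((continuous_const.add (continuous_sphereDot_right x)).div_const 2).continuousOn
    (fun y _ hy => by
      have := sphereDot_lt_one hy
      rw [sphereDot_self]; linarith)
    (fun y _ => by
      have := abs_le.1 (abs_sphereDot_le x y)
      linarith)
    (by rw [sphereDot_self]; norm_num) (by simp) (continuous_sphereEval F).continuousOn
  simp only [Measure.restrict_univ] at hpeak
  refine hpeak.congr' ?_
  filter_upwards [Filter.eventually_ge_atTop k] with N hN
  have hint (j : ℕ) : Integrable
      (fun y => (legendreFun j (sphereDot x y) : ℂ) * sphereEval F y) sphereMeasure :=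
    ((Complex.continuous_ofReal.comp (continuous_legendre_sphereDot j x)).mul
      (continuous_sphereEval F)).integrable_sphereMeasure
  have e : ∫ y, ((1 + sphereDot x y) / 2) ^ N • sphereEval F y ∂sphereMeasure =
      (q N k : ℂ) * ∫ y, (legendreFun k (sphereDot x y) : ℂ) * sphereEval F y ∂sphereMeasure := by
    have e1 (y) : ((1 + sphereDot x y) / 2) ^ N • sphereEval F y =
        ∑ j ∈ Finset.range (N + 1), (q N j : ℂ) *
          ((legendreFun j (sphereDot x y) : ℂ) * sphereEval F y) := by
      rw [hq, Complex.real_smul]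
      push_cast
      rw [Finset.sum_mul]
      simp only [mul_assoc]
    simp only [e1]
    rw [integral_finsetSum _ fun j _ => (hint j).const_mul _,
      Finset.sum_eq_single_of_mem k (by simp; omega), integral_const_mul]
    intro j _ hj
    rw [integral_const_mul, integral_legendre_mul_eq_zero hj hF, mul_zero]
  rw [e, Complex.real_smul]
  push_cast
  ring

lemma integral_zonalKernel_mul {k : ℕ} {F : MvPolynomial (Fin 3) ℂ} (hF : F ∈ solidHarmonics k)
    (x : UnitSphere) :
    ∫ y, (zonalKernel k x y : ℂ) * sphereEval F y ∂sphereMeasure = sphereEval F x := by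
  obtain ⟨r, hr⟩ := exists_tendsto_integral_legendre k x
  have hA := sphereArea_pos
  have hk : (0 : ℝ) < 2 * k + 1 := by positivity
  have h1 := hr _ (zonalAt_mem k x)
  simp only [sphereEval_zonalAt', sphereDot_self, legendreFun_at_one] at h1
  have h2 : ∫ y, (legendreFun k (sphereDot x y) : ℂ) * (legendreFun k (sphereDot x y) : ℂ)
      ∂sphereMeasure = ((sphereArea / (2 * k + 1) : ℝ) : ℂ) := by
    rw [← integral_legendre_sq k x, ← integral_complex_ofReal]
    simp [pow_two]
  rw [h2] at h1
  have h3 : Filter.Tendsto (fun N => (r N : ℂ)) Filter.atTop (nhds (zonalConst k : ℂ)) := by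
    have h4 := h1.mul_const ((zonalConst k : ℝ) : ℂ)
    refine (h4.congr fun N => ?_).trans (by simp)
    rw [mul_assoc, ← Complex.ofReal_mul, zonalConst]
    have : sphereArea / (2 * k + 1) * ((2 * k + 1) / sphereArea) = 1 := by field_simp
    rw [this]; simp
  have h5 := tendsto_nhds_unique (hr F hF) (h3.mul_const _)
  rw [h5, ← integral_const_mul]
  refine integral_congr_ae (Filter.Eventually.of_forall fun y => ?_)
  simp [zonalKernel, mul_assoc]

lemma norm_integral_mul_sq_le {α : Type*} [MeasurableSpace α] {μ : Measure α} {f g : α → ℂ}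
    (hf : MemLp f 2 μ) (hg : MemLp g 2 μ) :
    ‖∫ x, f x * g x ∂μ‖ ^ 2 ≤ (∫ x, ‖f x‖ ^ 2 ∂μ) * ∫ x, ‖g x‖ ^ 2 ∂μ := by
  have h1 : ‖∫ x, f x * g x ∂μ‖ ≤ ∫ x, ‖f x‖ * ‖g x‖ ∂μ :=
    (norm_integral_le_integral_norm _).trans_eq (by simp only [norm_mul])
  have h2 := integral_mul_norm_le_Lp_mul_Lq (μ := μ) (f := f) (g := g) Real.HolderConjugate.two_two
    (by simpa using hf) (by simpa using hg)
  have hF : 0 ≤ ∫ x, ‖f x‖ ^ 2 ∂μ := integral_nonneg fun x => by positivity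
  have hG : 0 ≤ ∫ x, ‖g x‖ ^ 2 ∂μ := integral_nonneg fun x => by positivity
  simp only [Real.rpow_two, ← Real.sqrt_eq_rpow] at h2
  calc ‖∫ x, f x * g x ∂μ‖ ^ 2
      ≤ (√(∫ x, ‖f x‖ ^ 2 ∂μ) * √(∫ x, ‖g x‖ ^ 2 ∂μ)) ^ 2 := by
        gcongr; exact h1.trans h2
    _ = _ := by rw [mul_pow, Real.sq_sqrt hF, Real.sq_sqrt hG]

lemma memLp_of_continuous {X : Type*} [TopologicalSpace X] [CompactSpace X] [MeasurableSpace X]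
    [BorelSpace X] [SecondCountableTopology X] {μ : Measure X} [IsFiniteMeasure μ] {f : X → ℂ}
    (hf : Continuous f) (p : ENNReal) : MemLp f p μ := by
  obtain ⟨M, hM⟩ := isCompact_univ.exists_bound_of_continuousOn hf.continuousOn
  exact MemLp.of_bound hf.aestronglyMeasurable M
    (Filter.Eventually.of_forall fun x => hM x (Set.mem_univ x))

section KernelEnergy

variable {X Y : Type*} [TopologicalSpace X] [CompactSpace X] [MeasurableSpace X] [BorelSpace X]
  [SecondCountableTopology X] [T2Space X] [TopologicalSpace Y] [CompactSpace Y]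
  [SecondCountableTopology Y] [T2Space Y] {μ : Measure X} [IsFiniteMeasure μ]
  {Φ : X → Y → ℝ} {h : X → ℂ} {F : Y → ℂ}

lemma continuous_kernel_integral (hΦ : Continuous Φ.uncurry) (hh : Continuous h) :
    Continuous fun y => ∫ x, (Φ x y : ℂ) * starRingEnd ℂ (h x) ∂μ := by
  have hc : Continuous fun q : Y × X => (Φ q.2 q.1 : ℂ) * starRingEnd ℂ (h q.2) := by
    simp only [Function.uncurry_def] at hΦ
    have : Continuous fun q : Y × X => Φ q.2 q.1 := hΦ.comp continuous_swap
    fun_prop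
  simpa using continuous_parametric_integral_of_continuous (μ := μ)
    (f := fun y x => (Φ x y : ℂ) * starRingEnd ℂ (h x)) hc isCompact_univ

variable [MeasurableSpace Y] [BorelSpace Y] {ν : Measure Y} [IsFiniteMeasure ν]

lemma norm_kernel_pairing_sq_le (hΦ : Continuous Φ.uncurry) (hh : Continuous h)
    (hF : Continuous F) :
    ‖∫ x, starRingEnd ℂ (h x) * ∫ y, (Φ x y : ℂ) * F y ∂ν ∂μ‖ ^ 2 ≤
      (∫ y, ‖F y‖ ^ 2 ∂ν) * ∫ y, ‖∫ x, (Φ x y : ℂ) * starRingEnd ℂ (h x) ∂μ‖ ^ 2 ∂ν := by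
  have e : ∫ x, starRingEnd ℂ (h x) * ∫ y, (Φ x y : ℂ) * F y ∂ν ∂μ =
      ∫ y, F y * ∫ x, (Φ x y : ℂ) * starRingEnd ℂ (h x) ∂μ ∂ν := by
    simp only [← integral_const_mul]
    rw [integral_integral_swap_of_hasCompactSupport]
    · refine integral_congr_ae (Filter.Eventually.of_forall fun y => ?_)
      refine integral_congr_ae (Filter.Eventually.of_forall fun x => ?_)
      simp only
      ring
    · simp only [Function.uncurry_def] at hΦ ⊢
      fun_prop
    · exact HasCompactSupport.of_compactSpace _
  rw [e]
  exact norm_integral_mul_sq_le (memLp_of_continuous hF 2)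
    (memLp_of_continuous (continuous_kernel_integral hΦ hh) 2)

lemma kernel_energy_eq (hΦ : Continuous Φ.uncurry) (hh : Continuous h) :
    ((∫ y, ‖∫ x, (Φ x y : ℂ) * starRingEnd ℂ (h x) ∂μ‖ ^ 2 ∂ν : ℝ) : ℂ) =
      ∫ q, starRingEnd ℂ (h q.1) * h q.2 * ((∫ y, Φ q.1 y * Φ q.2 y ∂ν : ℝ) : ℂ) ∂(μ.prod μ) := by
  have e (y) : ((‖∫ x, (Φ x y : ℂ) * starRingEnd ℂ (h x) ∂μ‖ ^ 2 : ℝ) : ℂ) =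
      ∫ q, ((Φ q.1 y : ℂ) * starRingEnd ℂ (h q.1)) * ((Φ q.2 y : ℂ) * h q.2) ∂(μ.prod μ) := by
    rw [integral_prod_mul (fun x => (Φ x y : ℂ) * starRingEnd ℂ (h x)) fun x => (Φ x y : ℂ) * h x]
    push_cast
    rw [← Complex.mul_conj', ← integral_conj]
    simp
  rw [← integral_complex_ofReal]
  simp only [e]
  rw [integral_integral_swap_of_hasCompactSupport]
  · refine integral_congr_ae (Filter.Eventually.of_forall fun q => ?_)
    simp only [← integral_complex_ofReal, ← integral_const_mul]
    refine integral_congr_ae (Filter.Eventually.of_forall fun y => ?_)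
    push_cast
    ring
  · simp only [Function.uncurry_def] at hΦ ⊢
    fun_prop
  · exact HasCompactSupport.of_compactSpace _

end KernelEnergy

lemma continuous_zonalKernel_right (k : ℕ) (x : UnitSphere) :
    Continuous fun y => zonalKernel k x y :=
  (continuous_zonalKernel k).comp (Continuous.prodMk_right x)

lemma integral_zonalKernel_mul_zonalKernel (j l : ℕ) (x x' : UnitSphere) :
    ∫ y, zonalKernel j x y * zonalKernel l x' y ∂sphereMeasure =
      if j = l then zonalKernel l x x' else 0 := by
  have e (y) : zonalKernel j x y * zonalKernel l x' y =
      zonalConst l * (zonalKernel j x y * legendreFun l (sphereDot x' y)) := by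
    rw [zonalKernel, zonalKernel]; ring
  have h1 : ((∫ y, zonalKernel j x y * legendreFun l (sphereDot x' y) ∂sphereMeasure : ℝ) : ℂ) =
      ∫ y, (zonalKernel j x y : ℂ) * sphereEval (zonalAt l x') y ∂sphereMeasure := by
    rw [← integral_complex_ofReal]
    simp [sphereEval_zonalAt']
  simp only [e, integral_const_mul]
  split_ifs with hjl
  · subst hjl
    rw [integral_zonalKernel_mul (zonalAt_mem j x'), sphereEval_zonalAt'] at h1
    rw [zonalKernel_comm, zonalKernel, Complex.ofReal_inj.1 h1]
  · have h2 : ∫ y, (zonalKernel j x y : ℂ) * sphereEval (zonalAt l x') y ∂sphereMeasure = 0 := by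
      have := integral_legendre_mul_eq_zero hjl (zonalAt_mem l x') x
      simp only [zonalKernel, Complex.ofReal_mul, mul_assoc, integral_const_mul, this, mul_zero]
    rw [h2] at h1
    rw [Complex.ofReal_eq_zero.1 h1, mul_zero]

/-- The squared `L²` norm of the projection of `h` to the spherical harmonics of degree `l`. -/
noncomputable def zonalEnergy (h : UnitSphere → ℂ) (l : ℕ) : ℝ :=
  ∫ y, ‖∫ x, (zonalKernel l x y : ℂ) * starRingEnd ℂ (h x) ∂sphereMeasure‖ ^ 2 ∂sphereMeasure

lemma zonalEnergy_nonneg (h : UnitSphere → ℂ) (l : ℕ) : 0 ≤ zonalEnergy h l :=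
  integral_nonneg fun _ => by positivity

lemma zonalEnergy_eq {h : UnitSphere → ℂ} (hh : Continuous h) (l : ℕ) :
    (zonalEnergy h l : ℂ) = ∫ q, starRingEnd ℂ (h q.1) * h q.2 * (zonalKernel l q.1 q.2 : ℂ)
      ∂(sphereMeasure.prod sphereMeasure) := by
  rw [zonalEnergy, kernel_energy_eq (continuous_zonalKernel l) hh]
  simp only [integral_zonalKernel_mul_zonalKernel, if_pos]

lemma zonalEnergy_eq_zero {h : UnitSphere → ℂ} {l : ℕ}
    (horth : ∀ P ∈ solidHarmonics l,
      ∫ x, starRingEnd ℂ (sphereEval P x) * h x ∂sphereMeasure = 0) : zonalEnergy h l = 0 := by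
  have h0 (y) : ∫ x, (zonalKernel l x y : ℂ) * starRingEnd ℂ (h x) ∂sphereMeasure = 0 := by
    have := congrArg (starRingEnd ℂ) (horth _ (zonalAt_mem l y))
    rw [← integral_conj] at this
    simp only [sphereEval_zonalAt', map_mul, Complex.conj_ofReal, map_zero] at this
    simp only [sphereDot_comm y] at this
    simp only [zonalKernel, Complex.ofReal_mul, mul_assoc,
      integral_const_mul, this, mul_zero]
  simp [zonalEnergy, h0]

lemma integral_quadratic_sum {h : UnitSphere → ℂ} (hh : Continuous h) (s : Finset ℕ) (c : ℕ → ℝ) :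
    ∫ q, starRingEnd ℂ (h q.1) * h q.2 * ((∑ l ∈ s, c l * zonalKernel l q.1 q.2 : ℝ) : ℂ)
      ∂(sphereMeasure.prod sphereMeasure) = ((∑ l ∈ s, c l * zonalEnergy h l : ℝ) : ℂ) := by
  have e (q : UnitSphere × UnitSphere) :
      starRingEnd ℂ (h q.1) * h q.2 * ((∑ l ∈ s, c l * zonalKernel l q.1 q.2 : ℝ) : ℂ) =
      ∑ l ∈ s, (c l : ℂ) * (starRingEnd ℂ (h q.1) * h q.2 * (zonalKernel l q.1 q.2 : ℂ)) := by
    push_cast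
    rw [Finset.mul_sum]
    exact Finset.sum_congr rfl fun l _ => by ring
  simp only [e]
  rw [integral_finsetSum]
  · push_cast
    simp only [integral_const_mul, zonalEnergy_eq hh]
  · intro l _
    have := continuous_zonalKernel l
    refine Continuous.integrable_of_hasCompactSupport ?_ (HasCompactSupport.of_compactSpace _)
    fun_prop

lemma sum_zonalEnergy_le {h : UnitSphere → ℂ} (hh : Continuous h) (s : Finset ℕ) :
    ∑ l ∈ s, zonalEnergy h l ≤ ∫ x, ‖h x‖ ^ 2 ∂sphereMeasure := by
  set Φ : UnitSphere → UnitSphere → ℝ := fun x y => ∑ l ∈ s, zonalKernel l x y with hΦ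
  have hc : Continuous Φ.uncurry := by
    rw [hΦ, Function.uncurry_def]
    exact continuous_finsetSum _ fun l _ => continuous_zonalKernel l
  have hcomp (x x') : ∫ y, Φ x y * Φ x' y ∂sphereMeasure = Φ x x' := by
    have e (y) : Φ x y * Φ x' y = ∑ j ∈ s, ∑ l ∈ s, zonalKernel j x y * zonalKernel l x' y := by
      rw [hΦ]; exact Finset.sum_mul_sum ..
    have hint (j l) : Integrable (fun y => zonalKernel j x y * zonalKernel l x' y) sphereMeasure :=
      ((continuous_zonalKernel_right j x).mul
        (continuous_zonalKernel_right l x')).integrable_sphereMeasure_real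
    simp only [e]
    rw [integral_finsetSum _ fun j _ => integrable_finsetSum _ fun l _ => hint j l]
    refine Finset.sum_congr rfl fun j hj => ?_
    rw [integral_finsetSum _ fun l _ => hint j l]
    simp [integral_zonalKernel_mul_zonalKernel, hj]
  have hsum := integral_quadratic_sum hh s 1
  simp only [Pi.one_apply, one_mul] at hsum
  have h1 := norm_kernel_pairing_sq_le (μ := sphereMeasure) (ν := sphereMeasure) hc hh hh
  have h2 := kernel_energy_eq (μ := sphereMeasure) (ν := sphereMeasure) hc hh
  simp only [hcomp] at h2
  rw [hsum, Complex.ofReal_inj] at h2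
  have h3 : ∫ x, starRingEnd ℂ (h x) * ∫ y, (Φ x y : ℂ) * h y ∂sphereMeasure ∂sphereMeasure =
      ((∑ l ∈ s, zonalEnergy h l : ℝ) : ℂ) := by
    rw [← hsum, integral_prod]
    · simp only [← integral_const_mul]
      refine integral_congr_ae (Filter.Eventually.of_forall fun x => ?_)
      refine integral_congr_ae (Filter.Eventually.of_forall fun y => ?_)
      simp only [hΦ]
      ring
    · refine Continuous.integrable_of_hasCompactSupport ?_ (HasCompactSupport.of_compactSpace _)
      simp only [Function.uncurry_def, hΦ] at hc
      fun_prop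
  rw [h3, h2, Complex.norm_real, Real.norm_eq_abs, sq_abs] at h1
  rcases (Finset.sum_nonneg fun l (_ : l ∈ s) => zonalEnergy_nonneg h l).eq_or_lt with h0 | h0
  · rw [← h0]; exact integral_nonneg fun _ => by positivity
  · rw [pow_two] at h1
    exact le_of_mul_le_mul_right h1 h0

lemma zonalKernel_cube (k : ℕ) (x y : UnitSphere) :
    zonalKernel k x y ^ 3 = ∑ l ∈ Finset.range (3 * k + 1),
      (zonalConst k ^ 3 * legendreCubeCoeff k l / zonalConst l) * zonalKernel l x y := by
  rw [zonalKernel, mul_pow, legendreFun_cube, Finset.mul_sum]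
  refine Finset.sum_congr rfl fun l _ => ?_
  have := (zonalConst_pos l).ne'
  rw [zonalKernel]
  field_simp

lemma zonalConst_cube_mul_le {k l : ℕ} (hl : 3 * k ≤ 2 * l + 1) :
    zonalConst k ^ 3 * legendreCubeCoeff k l / zonalConst l ≤
      160 / sphereArea ^ 2 * (k + 1) := by
  have hA := sphereArea_pos
  have h1 := legendreCubeCoeff_le k l hl
  have h2 : (2 * (k : ℝ) + 1) ≤ 2 * l + 1 := by
    have : 2 * k + 1 ≤ 2 * l + 1 := by omega
    exact_mod_cast this
  have hk : (0 : ℝ) < 2 * k + 1 := by positivity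
  calc zonalConst k ^ 3 * legendreCubeCoeff k l / zonalConst l
      ≤ zonalConst k ^ 3 * (40 / (k + 1)) / zonalConst k := by
        have := zonalConst_pos k
        have h3 : zonalConst k ≤ zonalConst l := by
          unfold zonalConst; gcongr
        gcongr
    _ = 40 * (2 * k + 1) ^ 2 / ((k + 1) * sphereArea ^ 2) := by
        unfold zonalConst; field_simp
    _ ≤ _ := by
        rw [div_mul_eq_mul_div, div_le_div_iff₀ (by positivity) (by positivity)]
        have : (40 * (2 * (k : ℝ) + 1) ^ 2) ≤ 160 * (k + 1) * (k + 1) := by nlinarith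
        calc _ ≤ 160 * ((k : ℝ) + 1) * (k + 1) * sphereArea ^ 2 := by gcongr
          _ = _ := by ring

lemma integral_norm_pow_six_le {k : ℕ} {P : MvPolynomial (Fin 3) ℂ} (hP : P ∈ solidHarmonics k)
    (horth : ∀ l, 2 * l + 1 < 3 * k → ∀ Q ∈ solidHarmonics l, sphereInner Q (P ^ 3) = 0) :
    ∫ x, ‖sphereEval P x‖ ^ 6 ∂sphereMeasure ≤ 160 / sphereArea ^ 2 * (k + 1) *
      (∫ x, ‖sphereEval P x‖ ^ 2 ∂sphereMeasure) ^ 3 := by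
  have hf := continuous_sphereEval P
  set f : UnitSphere → ℂ := sphereEval P with hfdef
  set h : UnitSphere → ℂ := fun x => f x ^ 3 with hdef
  have hh : Continuous h := hf.pow 3
  set I₆ := ∫ x, ‖f x‖ ^ 6 ∂sphereMeasure with hI₆
  have hh2 : ∫ x, ‖h x‖ ^ 2 ∂sphereMeasure = I₆ := by
    simp only [hdef, norm_pow, ← pow_mul, hI₆]
  set ν : Measure (UnitSphere × UnitSphere × UnitSphere) :=
    sphereMeasure.prod (sphereMeasure.prod sphereMeasure) with hν
  set Φ : UnitSphere → UnitSphere × UnitSphere × UnitSphere → ℝ := fun x y =>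
    zonalKernel k x y.1 * (zonalKernel k x y.2.1 * zonalKernel k x y.2.2) with hΦ
  set F : UnitSphere × UnitSphere × UnitSphere → ℂ := fun y => f y.1 * (f y.2.1 * f y.2.2)
    with hF
  have hFc : Continuous F := by fun_prop
  have hΦc : Continuous Φ.uncurry := by
    have := continuous_zonalKernel k
    rw [Function.uncurry_def]
    refine .mul (this.comp (f := fun q : UnitSphere × UnitSphere × UnitSphere × UnitSphere =>
      (q.1, q.2.1)) (by fun_prop)) (.mul (this.comp (f := fun
      q : UnitSphere × UnitSphere × UnitSphere × UnitSphere => (q.1, q.2.2.1)) (by fun_prop))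
      (this.comp (f := fun q : UnitSphere × UnitSphere × UnitSphere × UnitSphere =>
      (q.1, q.2.2.2)) (by fun_prop)))
  have hΦF (x) : ∫ y, (Φ x y : ℂ) * F y ∂ν = h x := by
    have e (y) : (Φ x y : ℂ) * F y = (zonalKernel k x y.1 * f y.1) *
        ((zonalKernel k x y.2.1 * f y.2.1) * (zonalKernel k x y.2.2 * f y.2.2)) := by
      simp only [hΦ, hF]; push_cast; ring
    simp only [e]
    rw [hν, integral_prod_mul (fun y => (zonalKernel k x y : ℂ) * f y)
      (fun y : UnitSphere × UnitSphere =>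
        (zonalKernel k x y.1 * f y.1) * (zonalKernel k x y.2 * f y.2)),
      integral_prod_mul (fun y => (zonalKernel k x y : ℂ) * f y)
        (fun y => (zonalKernel k x y : ℂ) * f y), integral_zonalKernel_mul hP]
    simp only [hdef, hfdef]; ring
  have hΦΦ (x x') : ∫ y, Φ x y * Φ x' y ∂ν = zonalKernel k x x' ^ 3 := by
    have e (y) : Φ x y * Φ x' y = (zonalKernel k x y.1 * zonalKernel k x' y.1) *
        ((zonalKernel k x y.2.1 * zonalKernel k x' y.2.1) *
          (zonalKernel k x y.2.2 * zonalKernel k x' y.2.2)) := by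
      simp only [hΦ]; ring
    simp only [e]
    rw [hν, integral_prod_mul (fun y => zonalKernel k x y * zonalKernel k x' y)
      (fun y : UnitSphere × UnitSphere =>
        (zonalKernel k x y.1 * zonalKernel k x' y.1) *
          (zonalKernel k x y.2 * zonalKernel k x' y.2)),
      integral_prod_mul (fun y => zonalKernel k x y * zonalKernel k x' y)
        (fun y => zonalKernel k x y * zonalKernel k x' y),
      integral_zonalKernel_mul_zonalKernel, if_pos rfl]
    ring
  have hFF : ∫ y, ‖F y‖ ^ 2 ∂ν = (∫ x, ‖f x‖ ^ 2 ∂sphereMeasure) ^ 3 := by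
    have e (y) : ‖F y‖ ^ 2 = ‖f y.1‖ ^ 2 * (‖f y.2.1‖ ^ 2 * ‖f y.2.2‖ ^ 2) := by
      simp only [hF, norm_mul]; ring
    simp only [e]
    rw [hν, integral_prod_mul (fun y => ‖f y‖ ^ 2)
      (fun y : UnitSphere × UnitSphere => ‖f y.1‖ ^ 2 * ‖f y.2‖ ^ 2),
      integral_prod_mul (fun y => ‖f y‖ ^ 2) (fun y => ‖f y‖ ^ 2)]
    ring
  have h1 := norm_kernel_pairing_sq_le (μ := sphereMeasure) (ν := ν) hΦc hh hFc
  have h2 := kernel_energy_eq (μ := sphereMeasure) (ν := ν) hΦc hh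
  simp only [hΦΦ, zonalKernel_cube] at h2
  rw [integral_quadratic_sum hh, Complex.ofReal_inj] at h2
  have h3 : ∫ x, starRingEnd ℂ (h x) * h x ∂sphereMeasure = (I₆ : ℂ) := by
    rw [← hh2, ← integral_complex_ofReal]
    simp only [Complex.conj_mul', Complex.ofReal_pow]
  simp only [hΦF] at h1
  rw [h3, h2, hFF, Complex.norm_real, Real.norm_eq_abs, sq_abs] at h1
  have h4 : ∑ l ∈ Finset.range (3 * k + 1),
      zonalConst k ^ 3 * legendreCubeCoeff k l / zonalConst l * zonalEnergy h l ≤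
      160 / sphereArea ^ 2 * (k + 1) * I₆ := by
    rw [← hh2]
    refine le_trans ?_ (mul_le_mul_of_nonneg_left
      (sum_zonalEnergy_le hh (Finset.range (3 * k + 1))) (by have := sphereArea_pos; positivity))
    rw [Finset.mul_sum]
    refine Finset.sum_le_sum fun l _ => ?_
    rcases le_or_gt (3 * k) (2 * l + 1) with hl | hl
    · exact mul_le_mul_of_nonneg_right (zonalConst_cube_mul_le hl) (zonalEnergy_nonneg h l)
    · have : zonalEnergy h l = 0 := zonalEnergy_eq_zero fun Q hQ => by
        have := horth l hl Q hQ
        simpa [sphereInner, pow_succ, sphereEval_mul, hdef] using this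
      rw [this, mul_zero, mul_zero]
  have hI : 0 ≤ I₆ := integral_nonneg fun _ => by positivity
  have hI2 : 0 ≤ ∫ x, ‖f x‖ ^ 2 ∂sphereMeasure := integral_nonneg fun _ => by positivity
  have hA := sphereArea_pos
  rcases hI.eq_or_lt with h0 | h0
  · rw [← h0]; positivity
  · have h5 := h1.trans (mul_le_mul_of_nonneg_left h4 (by positivity))
    refine le_of_mul_le_mul_right ?_ h0
    nlinarith [h5]

lemma integral_zonalKernel_sq (k : ℕ) (x : UnitSphere) :
    ∫ y, zonalKernel k x y ^ 2 ∂sphereMeasure = zonalConst k := by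
  simp only [pow_two, integral_zonalKernel_mul_zonalKernel, if_pos]
  rw [zonalKernel, sphereDot_self, legendreFun_at_one, mul_one]

lemma norm_sphereEval_sq_le {k : ℕ} {P : MvPolynomial (Fin 3) ℂ} (hP : P ∈ solidHarmonics k)
    (x : UnitSphere) :
    ‖sphereEval P x‖ ^ 2 ≤ zonalConst k * ∫ y, ‖sphereEval P y‖ ^ 2 ∂sphereMeasure := by
  have h := norm_integral_mul_sq_le (μ := sphereMeasure)
    (memLp_of_continuous (Complex.continuous_ofReal.comp (continuous_zonalKernel_right k x)) 2)
    (memLp_of_continuous (continuous_sphereEval P) 2)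
  simp only [Function.comp_apply, integral_zonalKernel_mul hP, Complex.norm_real,
    Real.norm_eq_abs, sq_abs, integral_zonalKernel_sq] at h
  exact h

lemma integral_norm_pow_six_le_zonalConst {k : ℕ} {P : MvPolynomial (Fin 3) ℂ}
    (hP : P ∈ solidHarmonics k) :
    ∫ x, ‖sphereEval P x‖ ^ 6 ∂sphereMeasure ≤
      zonalConst k ^ 2 * (∫ x, ‖sphereEval P x‖ ^ 2 ∂sphereMeasure) ^ 3 := by
  have hc := (continuous_sphereEval P).norm
  set I₂ := ∫ x, ‖sphereEval P x‖ ^ 2 ∂sphereMeasure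
  calc ∫ x, ‖sphereEval P x‖ ^ 6 ∂sphereMeasure
      ≤ ∫ x, (zonalConst k * I₂) ^ 2 * ‖sphereEval P x‖ ^ 2 ∂sphereMeasure := by
        refine integral_mono (hc.pow 6).integrable_sphereMeasure_real
          ((hc.pow 2).const_mul _).integrable_sphereMeasure_real fun x => ?_
        have := norm_sphereEval_sq_le hP x
        calc ‖sphereEval P x‖ ^ 6 = (‖sphereEval P x‖ ^ 2) ^ 2 * ‖sphereEval P x‖ ^ 2 := by ring
          _ ≤ _ := by gcongr
    _ = _ := by rw [integral_const_mul]; ring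

lemma eval_smul_of_isHomogeneous {σ R : Type*} [Fintype σ] [CommRing R] {k : ℕ}
    {P : MvPolynomial σ R} (hP : P.IsHomogeneous k) (r : R) (y : σ → R) :
    eval (fun i => r * y i) P = r ^ k * eval y P := by
  rw [eval_eq', eval_eq', Finset.mul_sum]
  refine Finset.sum_congr rfl fun d hd => ?_
  have h : ∑ i, d i = k := by
    rw [← Finsupp.degree_eq_sum, Finsupp.degree_eq_weight_one]
    exact hP (mem_support_iff.1 hd)
  simp only [mul_pow]
  rw [Finset.prod_mul_distrib, Finset.prod_pow_eq_pow_sum, h]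
  ring

lemma eq_zero_of_sphereInner_self {k : ℕ} {P : MvPolynomial (Fin 3) ℂ}
    (hP : P.IsHomogeneous k) (h : sphereInner P P = 0) : P = 0 := by
  rw [sphereInner_self, Complex.ofReal_eq_zero] at h
  have h0 (x : UnitSphere) : sphereEval P x = 0 := by
    by_contra hx
    refine h.not_gt (Continuous.integral_pos_of_hasCompactSupport_nonneg_nonzero (x := x)
      ((continuous_sphereEval P).norm.pow 2) (HasCompactSupport.of_compactSpace _)
      (fun x => by positivity) ?_)
    simpa using hx
  refine funext_set (fun _ => Set.range fun t : Set.Ioi (0 : ℝ) => ((t : ℝ) : ℂ)) (fun _ => ?_)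
    fun v hv => ?_
  · have : Infinite (Set.Ioi (0 : ℝ)) := (Set.Ioi_infinite 0).to_subtype
    exact Set.infinite_range_of_injective fun a b hab =>
      Subtype.ext (Complex.ofReal_injective hab)
  · rw [Set.mem_univ_pi] at hv
    choose t ht using hv
    set z : EuclideanSpace ℝ (Fin 3) := WithLp.toLp 2 fun i => (t i : ℝ) with hz
    have hz0 : z ≠ 0 := fun h0 => by
      have := congrArg (fun v : EuclideanSpace ℝ (Fin 3) => v 0) h0
      simp only [hz, PiLp.zero_apply] at this
      exact (t 0).2.ne' this
    have hn : ‖z‖ ≠ 0 := norm_ne_zero_iff.2 hz0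
    set x : UnitSphere := ⟨‖z‖⁻¹ • z, by simp [norm_smul, hn]⟩ with hx
    have e : v = fun i => (‖z‖ : ℂ) * (((x : EuclideanSpace ℝ (Fin 3)) i : ℝ) : ℂ) := by
      funext i
      rw [← ht i, ← Complex.ofReal_mul]
      simp only [hx, PiLp.smul_apply, smul_eq_mul, mul_inv_cancel_left₀ hn]
      rfl
    have := h0 x
    rw [sphereEval] at this
    rw [e, eval_smul_of_isHomogeneous hP, this, mul_zero, map_zero]

lemma finiteDimensional_solidHarmonics (k : ℕ) : FiniteDimensional ℂ (solidHarmonics k) := by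
  have h : solidHarmonics k ≤ restrictTotalDegree (Fin 3) ℂ k := fun P hP => by
    rw [mem_restrictTotalDegree]
    exact (mem_solidHarmonics.1 hP).1.totalDegree_le
  exact Submodule.finiteDimensional_of_le h

/-- The `L²` inner product on the solid harmonics of degree `k`. -/
noncomputable abbrev solidHarmonicsCore (k : ℕ) :
    InnerProductSpace.Core ℂ (solidHarmonics k) where
  inner P Q := sphereInner P Q
  conj_inner_symm P Q := sphereInner_conj_symm _ _
  re_inner_nonneg P := by
    change 0 ≤ (sphereInner P P).re
    rw [sphereInner_self, Complex.ofReal_re]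
    exact integral_nonneg fun _ => by positivity
  add_left P Q R := sphereInner_add_left _ _ _
  smul_left P Q c := sphereInner_smul_left _ _ _
  definite P h := Subtype.ext (eq_zero_of_sphereInner_self (mem_solidHarmonics.1 P.2).1 h)

lemma exists_weight_basis (k : ℕ) (i : Fin 3) :
    ∃ (n : ℕ) (b : Fin n → MvPolynomial (Fin 3) ℂ) (w : Fin n → ℝ),
      (∀ j, b j ∈ solidHarmonics k) ∧
      (∀ j, rotDeriv i (b j) = (Complex.I * w j) • b j) ∧
      (∀ j l, sphereInner (b j) (b l) = if j = l then 1 else 0) ∧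
      ∀ P ∈ solidHarmonics k, P = ∑ j, sphereInner (b j) P • b j := by
  let cd : InnerProductSpace.Core ℂ (solidHarmonics k) := solidHarmonicsCore k
  let : NormedAddCommGroup (solidHarmonics k) := cd.toNormedAddCommGroup
  let : InnerProductSpace ℂ (solidHarmonics k) := InnerProductSpace.ofCore cd.toCore
  have := finiteDimensional_solidHarmonics k
  let T : solidHarmonics k →ₗ[ℂ] solidHarmonics k :=
    (-Complex.I) • (rotDeriv i).toLinearMap.restrict fun P hP => rotDeriv_mem i hP
  have hTv (P : solidHarmonics k) : ((T P : solidHarmonics k) : MvPolynomial (Fin 3) ℂ) =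
      (-Complex.I) • rotDeriv i P := rfl
  have hinner (P Q : solidHarmonics k) : inner ℂ P Q = sphereInner P Q := rfl
  have hT : T.IsSymmetric := fun P Q => by
    rw [hinner, hinner, hTv, hTv, sphereInner_smul_left, sphereInner_smul_right,
      sphereInner_rotDeriv_left]
    simp
  set B := hT.eigenvectorBasis rfl with hB
  refine ⟨_, fun j => B j, hT.eigenvalues rfl, fun j => (B j).2, fun j => ?_, fun j l => ?_,
    fun P hP => ?_⟩
  · have h := congrArg Subtype.val (hT.apply_eigenvectorBasis rfl j)
    rw [hTv] at h
    have h2 := congrArg (fun R => Complex.I • R) h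
    simp only [Submodule.coe_smul, smul_smul, mul_neg, Complex.I_mul_I, neg_neg, one_smul] at h2
    exact h2
  · rw [← hinner]
    exact orthonormal_iff_ite.1 B.orthonormal j l
  · have h := congrArg Subtype.val (B.sum_repr' ⟨P, hP⟩)
    simp only [Submodule.coe_sum, Submodule.coe_smul, hinner] at h
    exact h.symm

section Weights

variable {i : Fin 3} {k : ℕ}

lemma rotDeriv_mul_of_weight {P Q : MvPolynomial (Fin 3) ℂ} {a b : ℝ}
    (hP : rotDeriv i P = (Complex.I * a) • P) (hQ : rotDeriv i Q = (Complex.I * b) • Q) :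
    rotDeriv i (P * Q) = (Complex.I * ((a + b : ℝ) : ℂ)) • (P * Q) := by
  rw [Derivation.leibniz, hP, hQ]
  push_cast
  rw [mul_add, add_smul, smul_eq_mul, smul_eq_mul, mul_smul_comm, mul_smul_comm, mul_comm Q P,
    add_comm]

lemma sphereInner_eq_zero_of_weight_ne {P Q : MvPolynomial (Fin 3) ℂ} {a b : ℝ} (hab : a ≠ b)
    (hP : rotDeriv i P = (Complex.I * a) • P) (hQ : rotDeriv i Q = (Complex.I * b) • Q) :
    sphereInner P Q = 0 := by
  have h := sphereInner_rotDeriv_left i P Q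
  rw [hP, hQ, sphereInner_smul_left, sphereInner_smul_right] at h
  simp only [map_mul, Complex.conj_I, Complex.conj_ofReal] at h
  have h2 : Complex.I * ((a : ℂ) - b) * sphereInner P Q = 0 := by linear_combination -h
  have h3 : (a : ℂ) - b ≠ 0 := sub_ne_zero.2 (by exact_mod_cast hab)
  simpa [h3] using h2

lemma weight_sq_le {P : MvPolynomial (Fin 3) ℂ} {w : ℝ} (hP : P ∈ solidHarmonics k)
    (hw : rotDeriv i P = (Complex.I * w) • P) (h1 : sphereInner P P = 1) :
    w ^ 2 ≤ k * (k + 1) := by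
  have h := sum_sphereInner_rotDeriv hP P
  rw [h1, mul_one] at h
  have hi : sphereInner (rotDeriv i P) (rotDeriv i P) = ((w ^ 2 : ℝ) : ℂ) := by
    rw [hw, sphereInner_smul_left, sphereInner_smul_right, h1]
    simp only [map_mul, Complex.conj_I, Complex.conj_ofReal]
    push_cast
    linear_combination -(w : ℂ) ^ 2 * Complex.I_mul_I
  set e : Fin 3 → ℝ := fun j => ∫ x, ‖sphereEval (rotDeriv j P) x‖ ^ 2 ∂sphereMeasure with he
  have hs (j) : sphereInner (rotDeriv j P) (rotDeriv j P) = (e j : ℂ) := sphereInner_self _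
  simp only [hs] at h hi
  rw [← Complex.ofReal_inj.1 hi]
  have h2 : ∑ j, e j = k * (k + 1) := by exact_mod_cast h
  rw [← h2]
  exact Finset.single_le_sum (f := e) (fun j _ => integral_nonneg fun _ => by positivity)
    (Finset.mem_univ i)

lemma sphereInner_eq_zero_of_weight_gt {l : ℕ} (hl : 2 * l + 1 < 3 * k)
    {Q R : MvPolynomial (Fin 3) ℂ} (hQ : Q ∈ solidHarmonics l) {ε v : ℝ} (hε : ε ^ 2 = 1)
    (hR : rotDeriv i R = (Complex.I * v) • R) (hv : 3 * (k : ℝ) / 2 < ε * v) :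
    sphereInner Q R = 0 := by
  obtain ⟨n, b, w, hb, hw, hbb, hexp⟩ := exists_weight_basis l i
  rw [← sphereInner_conj_symm, hexp Q hQ, sphereInner_sum_right, Finset.sum_eq_zero, map_zero]
  intro j _
  have hne : v ≠ w j := by
    rintro rfl
    have h1 : (ε * w j) ^ 2 ≤ l * (l + 1) := by
      rw [mul_pow, hε, one_mul]
      exact weight_sq_le (hb j) (hw j) (by simp [hbb])
    have h2 : (2 * (l : ℝ) + 1) < 3 * k := by exact_mod_cast hl
    nlinarith
  rw [sphereInner_smul_right, sphereInner_eq_zero_of_weight_ne hne hR (hw j), mul_zero]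

lemma sphereInner_cube_eq_zero {n : ℕ} {b : Fin n → MvPolynomial (Fin 3) ℂ} {w : Fin n → ℝ}
    (hw : ∀ j, rotDeriv i (b j) = (Complex.I * w j) • b j) {c : Fin n → ℂ} {ε : ℝ}
    (hε : ε ^ 2 = 1) (hc : ∀ j, c j ≠ 0 → (k : ℝ) / 2 < ε * w j) {l : ℕ}
    (hl : 2 * l + 1 < 3 * k) {Q : MvPolynomial (Fin 3) ℂ} (hQ : Q ∈ solidHarmonics l) :
    sphereInner Q ((∑ j, c j • b j) ^ 3) = 0 := by
  rw [pow_three, Finset.sum_mul_sum, Finset.sum_mul_sum]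
  simp only [Finset.mul_sum, sphereInner_sum_right]
  refine Finset.sum_eq_zero fun x _ => Finset.sum_eq_zero fun y _ => Finset.sum_eq_zero fun z _ =>
    ?_
  simp only [smul_mul_assoc, mul_smul_comm, sphereInner_smul_right]
  by_cases hx : c x = 0
  · simp [hx]
  by_cases hy : c y = 0
  · simp [hy]
  by_cases hz : c z = 0
  · simp [hz]
  rw [sphereInner_eq_zero_of_weight_gt hl hQ hε
    (rotDeriv_mul_of_weight (hw _) (rotDeriv_mul_of_weight (hw _) (hw _)))
    (by have := hc x hx; have := hc y hy; have := hc z hz; linarith)]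
  simp

lemma integral_norm_sq_sum_smul {n : ℕ} {b : Fin n → MvPolynomial (Fin 3) ℂ}
    (hb : ∀ j l, sphereInner (b j) (b l) = if j = l then 1 else 0) (c : Fin n → ℂ) :
    ∫ x, ‖sphereEval (∑ j, c j • b j) x‖ ^ 2 ∂sphereMeasure = ∑ j, ‖c j‖ ^ 2 := by
  have h (j) : sphereInner (b j) (∑ l, c l • b l) = c j := by
    simp [sphereInner_sum_right, sphereInner_smul_right, hb]
  have h2 := sphereInner_self (∑ j, c j • b j)
  rw [sphereInner_sum_right] at h2
  have h3 (j) : sphereInner (∑ l, c l • b l) (c j • b j) = ((‖c j‖ ^ 2 : ℝ) : ℂ) := by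
    rw [sphereInner_smul_right, ← sphereInner_conj_symm, h, Complex.mul_conj']
    push_cast
    rfl
  simp only [h3] at h2
  exact_mod_cast h2.symm

end Weights

/-- The `L²` norm on the sphere. -/
noncomputable def sphereNorm₂ (P : MvPolynomial (Fin 3) ℂ) : ℝ :=
  √(∫ x, ‖sphereEval P x‖ ^ 2 ∂sphereMeasure)

/-- The `L⁶` norm on the sphere. -/
noncomputable def sphereNorm₆ (P : MvPolynomial (Fin 3) ℂ) : ℝ :=
  lpNorm (sphereEval P) 6 sphereMeasure

lemma sphereNorm₂_sq (P : MvPolynomial (Fin 3) ℂ) :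
    sphereNorm₂ P ^ 2 = ∫ x, ‖sphereEval P x‖ ^ 2 ∂sphereMeasure :=
  Real.sq_sqrt (integral_nonneg fun _ => by positivity)

lemma sphereNorm₂_nonneg (P : MvPolynomial (Fin 3) ℂ) : 0 ≤ sphereNorm₂ P := Real.sqrt_nonneg _

lemma sphereNorm₆_pow (P : MvPolynomial (Fin 3) ℂ) :
    sphereNorm₆ P ^ 6 = ∫ x, ‖sphereEval P x‖ ^ 6 ∂sphereMeasure := by
  have h : (ENNReal.toReal 6) = ((6 : ℕ) : ℝ) := by norm_num
  rw [sphereNorm₆, lpNorm_eq_integral_norm_rpow_toReal (by norm_num) (by norm_num)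
    (continuous_sphereEval P).aestronglyMeasurable, h]
  simp only [Real.rpow_natCast]
  exact Real.rpow_inv_natCast_pow (integral_nonneg fun _ => by positivity) (by norm_num)

lemma sphereNorm₆_add_le (P Q : MvPolynomial (Fin 3) ℂ) :
    sphereNorm₆ (P + Q) ≤ sphereNorm₆ P + sphereNorm₆ Q := by
  have h : sphereEval (P + Q) = sphereEval P + sphereEval Q := by
    ext x
    rw [Pi.add_apply, sphereEval_add]
  rw [sphereNorm₆, h]
  exact lpNorm_add_le (memLp_of_continuous (continuous_sphereEval P) 6) (by norm_num)

lemma sphereNorm₆_smul (c : ℂ) (P : MvPolynomial (Fin 3) ℂ) :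
    sphereNorm₆ (c • P) = ‖c‖ * sphereNorm₆ P := by
  have h : sphereEval (c • P) = c • sphereEval P := funext fun x => by
    simp [sphereEval_smul]
  rw [sphereNorm₆, h, lpNorm_const_smul, coe_nnnorm, sphereNorm₆]

lemma sphereNorm₆_le_of_integral_le {P : MvPolynomial (Fin 3) ℂ} {A B : ℝ} (hA : 0 ≤ A)
    (hAB : A ^ 6 = B) (h : ∫ x, ‖sphereEval P x‖ ^ 6 ∂sphereMeasure ≤
      B * (∫ x, ‖sphereEval P x‖ ^ 2 ∂sphereMeasure) ^ 3) :
    sphereNorm₆ P ≤ A * sphereNorm₂ P := by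
  refine le_of_pow_le_pow_left₀ (n := 6) (by norm_num)
    (mul_nonneg hA (sphereNorm₂_nonneg P)) ?_
  rw [sphereNorm₆_pow, mul_pow, hAB]
  refine h.trans_eq ?_
  rw [← sphereNorm₂_sq]
  ring

section Absorption

variable {k : ℕ} {A M : ℝ}

lemma sphereNorm₆_rotDeriv_sq_le (hA : 0 ≤ A)
    (hAk : A ^ 6 = 160 / sphereArea ^ 2 * (k + 1)) (hM0 : 0 ≤ M)
    (hM : ∀ P ∈ solidHarmonics k, sphereNorm₆ P ≤ M * sphereNorm₂ P)
    {P : MvPolynomial (Fin 3) ℂ} (hP : P ∈ solidHarmonics k) (i : Fin 3) :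
    sphereNorm₆ (rotDeriv i (rotDeriv i P)) ≤
      (2 * A + M / 4) * (k * (k + 1)) * sphereNorm₂ P := by
  obtain ⟨n, b, w, hb, hw, hbb, hexp⟩ := exists_weight_basis k i
  set s : Fin n → ℂ := fun j => sphereInner (b j) P with hs
  have hPs : P = ∑ j, s j • b j := hexp P hP
  have hw2 (j) : w j ^ 2 ≤ k * (k + 1) := weight_sq_le (hb j) (hw j) (by simp [hbb])
  have hmem (c : Fin n → ℂ) : ∑ j, c j • b j ∈ solidHarmonics k :=
    Submodule.sum_mem _ fun j _ => Submodule.smul_mem _ _ (hb j)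
  have hnorm (v : Fin n → ℝ) (W : ℝ) (hW : 0 ≤ W) (hv : ∀ j, |v j| ≤ W) :
      sphereNorm₂ (∑ j, (v j * s j) • b j) ≤ W * sphereNorm₂ P := by
    refine le_of_pow_le_pow_left₀ (n := 2) (by norm_num)
      (mul_nonneg hW (sphereNorm₂_nonneg P)) ?_
    rw [mul_pow, sphereNorm₂_sq, sphereNorm₂_sq, integral_norm_sq_sum_smul hbb, hPs,
      integral_norm_sq_sum_smul hbb, Finset.mul_sum]
    refine Finset.sum_le_sum fun j _ => ?_
    rw [norm_mul, mul_pow, Complex.norm_real, Real.norm_eq_abs]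
    gcongr
    exact hv j
  have hlarge (ε : ℝ) (hε : ε ^ 2 = 1) :
      sphereNorm₆ (∑ j, (((if (k : ℝ) / 2 < ε * w j then w j ^ 2 else 0 : ℝ) : ℂ) * s j) • b j) ≤
        A * (k * (k + 1) * sphereNorm₂ P) := by
    refine (sphereNorm₆_le_of_integral_le hA hAk (integral_norm_pow_six_le (hmem _)
      fun l hl Q hQ => sphereInner_cube_eq_zero hw hε (fun j hj => ?_) hl hQ)).trans ?_
    · by_contra h
      simp [h] at hj
    · refine mul_le_mul_of_nonneg_left (hnorm _ _ (by positivity) fun j => ?_) hA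
      split_ifs
      · rw [abs_of_nonneg (by positivity)]; exact hw2 j
      · rw [abs_zero]; positivity
  have hsmall :
      sphereNorm₆ (∑ j, (((if |w j| ≤ (k : ℝ) / 2 then w j ^ 2 else 0 : ℝ) : ℂ) * s j) • b j) ≤
        M * ((k : ℝ) ^ 2 / 4 * sphereNorm₂ P) := by
    refine (hM _ (hmem _)).trans (mul_le_mul_of_nonneg_left (hnorm _ _ (by positivity)
      fun j => ?_) hM0)
    split_ifs with h
    · rw [abs_of_nonneg (by positivity), ← sq_abs]
      calc |w j| ^ 2 ≤ ((k : ℝ) / 2) ^ 2 := by gcongr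
        _ = _ := by ring
    · rw [abs_zero]; positivity
  have hdecomp : rotDeriv i (rotDeriv i P) = (-1 : ℂ) •
      ((∑ j, (((if (k : ℝ) / 2 < 1 * w j then w j ^ 2 else 0 : ℝ) : ℂ) * s j) • b j +
      ∑ j, (((if (k : ℝ) / 2 < (-1) * w j then w j ^ 2 else 0 : ℝ) : ℂ) * s j) • b j) +
      ∑ j, (((if |w j| ≤ (k : ℝ) / 2 then w j ^ 2 else 0 : ℝ) : ℂ) * s j) • b j) := by
    conv_lhs => rw [hPs]
    simp only [map_sum, Derivation.map_smul, hw, smul_smul, ← Finset.sum_add_distrib,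
      Finset.smul_sum, ← add_smul]
    refine Finset.sum_congr rfl fun j _ => ?_
    congr 1
    have hsplit : (if (k : ℝ) / 2 < 1 * w j then w j ^ 2 else 0 : ℝ) +
        (if (k : ℝ) / 2 < (-1) * w j then w j ^ 2 else 0 : ℝ) +
        (if |w j| ≤ (k : ℝ) / 2 then w j ^ 2 else 0 : ℝ) = w j ^ 2 := by
      have hk : (0 : ℝ) ≤ k := by positivity
      simp only [abs_le]
      split_ifs with h1 h2 h3 h3 h2 h3 h3 <;> simp
      all_goals exfalso
      all_goals first
        | linarith
        | linarith [h3.1]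
        | linarith [h3.2]
        | exact h3 ⟨by linarith, by linarith⟩
    have hc := congrArg (fun r : ℝ => (r : ℂ)) hsplit
    simp only [Complex.ofReal_add] at hc
    rw [← add_mul, ← add_mul, hc]
    push_cast
    linear_combination (s j * (w j : ℂ) ^ 2) * Complex.I_mul_I
  rw [hdecomp, sphereNorm₆_smul]
  have h1 := hlarge 1 (by norm_num)
  have h2 := hlarge (-1) (by norm_num)
  have hadd := (sphereNorm₆_add_le _ _).trans (add_le_add (sphereNorm₆_add_le _ _) le_rfl) |>.trans
    (add_le_add (add_le_add h1 h2) hsmall)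
  rw [norm_neg, norm_one, one_mul]
  refine hadd.trans ?_
  have hn := sphereNorm₂_nonneg P
  have : 0 ≤ M * sphereNorm₂ P * (k : ℝ) := by positivity
  nlinarith

lemma sphereNorm₆_absorb (hk : k ≠ 0) (hA : 0 ≤ A)
    (hAk : A ^ 6 = 160 / sphereArea ^ 2 * (k + 1)) (hM0 : 0 ≤ M)
    (hM : ∀ P ∈ solidHarmonics k, sphereNorm₆ P ≤ M * sphereNorm₂ P)
    {P : MvPolynomial (Fin 3) ℂ} (hP : P ∈ solidHarmonics k) :
    sphereNorm₆ P ≤ (6 * A + 3 / 4 * M) * sphereNorm₂ P := by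
  have hcas := casimir hP
  have hk0 : (0 : ℝ) < k := by positivity
  have h1 : ((-((k : ℂ) * (k + 1)))) • P = ∑ i, rotDeriv i (rotDeriv i P) := by
    rw [hcas, neg_smul, ← Nat.cast_smul_eq_nsmul ℂ]
    push_cast
    rfl
  have h2 := congrArg sphereNorm₆ h1
  have h3 : ‖((k : ℂ) * (k + 1))‖ = (k : ℝ) * (k + 1) := by
    rw [show ((k : ℂ) * (k + 1)) = ((k * (k + 1) : ℕ) : ℂ) by push_cast; rfl, Complex.norm_natCast]
    push_cast
    rfl
  rw [sphereNorm₆_smul, norm_neg, h3, Fin.sum_univ_three] at h2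
  have h4 := (sphereNorm₆_add_le _ _).trans (add_le_add (sphereNorm₆_add_le _ _) le_rfl) |>.trans
    (add_le_add (add_le_add (sphereNorm₆_rotDeriv_sq_le hA hAk hM0 hM hP 0)
      (sphereNorm₆_rotDeriv_sq_le hA hAk hM0 hM hP 1))
      (sphereNorm₆_rotDeriv_sq_le hA hAk hM0 hM hP 2))
  rw [← h2] at h4
  refine le_of_mul_le_mul_left (h4.trans_eq ?_) (show (0 : ℝ) < k * (k + 1) by positivity)
  ring

lemma sphereNorm₆_le (hA : 0 ≤ A) (hAk : A ^ 6 = 160 / sphereArea ^ 2 * (k + 1))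
    {P : MvPolynomial (Fin 3) ℂ} (hP : P ∈ solidHarmonics k) :
    sphereNorm₆ P ≤ 24 * A * sphereNorm₂ P := by
  have hn := sphereNorm₂_nonneg P
  rcases eq_or_ne k 0 with rfl | hk
  · refine (sphereNorm₆_le_of_integral_le hA hAk
      (integral_norm_pow_six_le hP fun l hl => absurd hl (by omega))).trans ?_
    nlinarith [mul_nonneg hA hn]
  obtain ⟨M, hM0, hM⟩ : ∃ M : ℝ, 0 ≤ M ∧
      ∀ P ∈ solidHarmonics k, sphereNorm₆ P ≤ M * sphereNorm₂ P := by
    have hz := zonalConst_pos k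
    refine ⟨(zonalConst k ^ 2) ^ ((6 : ℕ) : ℝ)⁻¹, by positivity, fun P hP =>
      sphereNorm₆_le_of_integral_le (by positivity)
        (Real.rpow_inv_natCast_pow (by positivity) (by norm_num))
        (integral_norm_pow_six_le_zonalConst hP)⟩
  have key (m : ℕ) : ∀ P ∈ solidHarmonics k,
      sphereNorm₆ P ≤ (24 * A + (3 / 4) ^ m * M) * sphereNorm₂ P := by
    induction m with
    | zero =>
      intro P hP
      refine (hM P hP).trans (mul_le_mul_of_nonneg_right ?_ (sphereNorm₂_nonneg P))
      linarith
    | succ m ih =>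
      intro P hP
      refine (sphereNorm₆_absorb hk hA hAk (by positivity) ih hP).trans_eq ?_
      ring
  have ht : Filter.Tendsto (fun m : ℕ => (24 * A + (3 / 4 : ℝ) ^ m * M) * sphereNorm₂ P)
      Filter.atTop (nhds ((24 * A + 0 * M) * sphereNorm₂ P)) :=
    (((tendsto_pow_atTop_nhds_zero_of_lt_one (by norm_num) (by norm_num)).mul_const M).const_add
      _).mul_const _
  rw [zero_mul, add_zero] at ht
  exact ge_of_tendsto' ht fun m => key m P hP

end Absorption

lemma eLpNorm_ofReal_eq_lintegral {α : Type*} [MeasurableSpace α] {μ : Measure α} (f : α → ℂ)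
    {p : ℝ} (hp : 0 < p) :
    eLpNorm f (ENNReal.ofReal p) μ = (∫⁻ x, ‖f x‖ₑ ^ p ∂μ) ^ (1 / p) := by
  rw [eLpNorm_eq_lintegral_rpow_enorm_toReal (ENNReal.ofReal_pos.2 hp).ne' ENNReal.ofReal_ne_top,
    ENNReal.toReal_ofReal hp.le]

lemma eLpNorm_le_eLpNorm_two_mul_eLpNorm_six {α : Type*} [MeasurableSpace α] {μ : Measure α}
    {f : α → ℂ} (hf : AEStronglyMeasurable f μ) {p : ℝ} (hp2 : 2 ≤ p) (hp6 : p ≤ 6) :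
    eLpNorm f (ENNReal.ofReal p) μ ≤
      eLpNorm f 2 μ ^ ((6 - p) / (2 * p)) * eLpNorm f 6 μ ^ (3 * (p - 2) / (2 * p)) := by
  have hp : 0 < p := by linarith
  have e2 : eLpNorm f 2 μ = (∫⁻ x, ‖f x‖ₑ ^ (2 : ℝ) ∂μ) ^ (1 / 2 : ℝ) := by
    rw [← eLpNorm_ofReal_eq_lintegral f two_pos, ENNReal.ofReal_ofNat]
  have e6 : eLpNorm f 6 μ = (∫⁻ x, ‖f x‖ₑ ^ (6 : ℝ) ∂μ) ^ (1 / 6 : ℝ) := by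
    rw [← eLpNorm_ofReal_eq_lintegral f (by norm_num), ENNReal.ofReal_ofNat]
  have h := ENNReal.lintegral_mul_norm_pow_le (μ := μ) (hf.enorm.pow_const (2 : ℝ))
    (hf.enorm.pow_const (6 : ℝ)) (p := (6 - p) / 4) (q := (p - 2) / 4) (by linarith)
    (by linarith) (by ring)
  have e (x) : (‖f x‖ₑ ^ (2 : ℝ)) ^ ((6 - p) / 4) * (‖f x‖ₑ ^ (6 : ℝ)) ^ ((p - 2) / 4) =
      ‖f x‖ₑ ^ p := by
    rw [← ENNReal.rpow_mul, ← ENNReal.rpow_mul,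
      ← ENNReal.rpow_add_of_nonneg _ _ (by linarith) (by linarith)]
    congr 1; ring
  simp only [e] at h
  rw [eLpNorm_ofReal_eq_lintegral f hp, e2, e6]
  refine (ENNReal.rpow_le_rpow h (by positivity)).trans_eq ?_
  rw [ENNReal.mul_rpow_of_nonneg _ _ (by positivity)]
  simp only [← ENNReal.rpow_mul]
  congr 2 <;> field_simp <;> ring

lemma eLpNorm_six_le {k : ℕ} {P : MvPolynomial (Fin 3) ℂ} (hP : P ∈ solidHarmonics k) :
    eLpNorm (sphereEval P) 6 sphereMeasure ≤
      ENNReal.ofReal (24 * (160 / sphereArea ^ 2) ^ (1 / 6 : ℝ) * (1 + (k : ℝ)) ^ (1 / 6 : ℝ)) *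
        eLpNorm (sphereEval P) 2 sphereMeasure := by
  have hA := sphereArea_pos
  have hc := continuous_sphereEval P
  have h := sphereNorm₆_le (A := (160 / sphereArea ^ 2) ^ (1 / 6 : ℝ) * (1 + (k : ℝ)) ^ (1 / 6 : ℝ))
    (by positivity) (by
      have hroot {a : ℝ} (ha : 0 ≤ a) : (a ^ (1 / 6 : ℝ)) ^ 6 = a := by
        rw [← Real.rpow_mul_natCast ha]
        norm_num
      rw [mul_pow, hroot (by positivity), hroot (by positivity), add_comm 1]) hP
  have h2 : sphereNorm₂ P = lpNorm (sphereEval P) 2 sphereMeasure := by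
    rw [lpNorm_eq_integral_norm_rpow_toReal (by norm_num) (by norm_num) hc.aestronglyMeasurable,
      sphereNorm₂, Real.sqrt_eq_rpow]
    simp
  rw [h2, sphereNorm₆] at h
  rw [← ofReal_lpNorm (memLp_of_continuous hc 6), ← ofReal_lpNorm (memLp_of_continuous hc 2),
    ← ENNReal.ofReal_mul (by positivity), mul_assoc 24]
  exact ENNReal.ofReal_le_ofReal h

/-- Sogge's `L^p` eigenfunction estimate on `S²` in the range `2 ≤ p ≤ 6`:
`‖f‖_{L^p(S²)} ≤ C (1+k)^{(p−2)/(4p)} ‖f‖_{L²(S²)}` for `f ∈ ℋ_k`. -/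
theorem sogge_Lp_estimate_low (p : ℝ) (hp2 : 2 ≤ p) (hp6 : p ≤ 6) :
    ∃ C : ℝ, 0 < C ∧ ∀ (k : ℕ) (f : sphere (0 : EuclideanSpace ℝ (Fin 3)) 1 → ℂ),
      IsSphericalHarmonic k f →
      eLpNorm f (ENNReal.ofReal p) sphereMeasure ≤
        ENNReal.ofReal (C * (1 + (k : ℝ)) ^ ((p - 2) / (4 * p))) *
          eLpNorm f 2 sphereMeasure := by
  have hA := sphereArea_pos
  set D : ℝ := 24 * (160 / sphereArea ^ 2) ^ (1 / 6 : ℝ) with hD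
  have hD0 : 0 < D := by positivity
  refine ⟨D ^ (3 * (p - 2) / (2 * p)), by positivity, ?_⟩
  rintro k f ⟨P, hPh, hPl, hPf⟩
  have hP : P ∈ solidHarmonics k :=
    mem_solidHarmonics.2 ⟨hPh, by rw [polyLaplacian_apply]; exact hPl⟩
  obtain rfl : f = sphereEval P := funext hPf
  have hθ : 0 ≤ 3 * (p - 2) / (2 * p) := div_nonneg (by linarith) (by linarith)
  have hη : 0 ≤ (6 - p) / (2 * p) := div_nonneg (by linarith) (by linarith)
  have hp : p ≠ 0 := by linarith
  refine (eLpNorm_le_eLpNorm_two_mul_eLpNorm_six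
    (continuous_sphereEval P).aestronglyMeasurable hp2 hp6).trans ?_
  refine (mul_le_mul_right (ENNReal.rpow_le_rpow (eLpNorm_six_le hP) hθ) _).trans_eq ?_
  rw [ENNReal.mul_rpow_of_nonneg _ _ hθ, mul_left_comm, ← ENNReal.rpow_add_of_nonneg _ _ hη hθ,
    ENNReal.ofReal_rpow_of_nonneg (by positivity) hθ, Real.mul_rpow hD0.le (by positivity),
    ← Real.rpow_mul (by positivity)]
  have e1 : (6 - p) / (2 * p) + 3 * (p - 2) / (2 * p) = 1 := by field_simp; ring
  have e2 : 1 / 6 * (3 * (p - 2) / (2 * p)) = (p - 2) / (4 * p) := by field_simp; ring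
  rw [e1, e2, ENNReal.rpow_one]
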